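/- arXiv:2409.02623 — 2 statements merged into one kernel-verified Lean document; each statement's English description precedes it below -/
import Mathlib

section
/- For any real parameters ρ_α, ρ_β ≥ 0, the Widom factors satisfy 𝒲_n(ρ_α,ρ_β) → 2^{1-ρ_α-ρ_β} as n → ∞. -/
open Filter

/-- The weighted sup `sup_{x ∈ [-1,1]} (1-x)^ρα (1+x)^ρβ |P(x)|`. -/
noncomputable def jacobiSup (ρa ρb : ℝ) (P : Polynomial ℝ) : ℝ :=
  sSup ((fun x : ℝ => (1 - x) ^ ρa * (1 + x) ^ ρb * |P.eval x|) '' Set.Icc (-1 : ℝ) 1)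

/-- The Widom factor `𝒲_n(ρα, ρβ)` for the Jacobi weight `(1-x)^ρα (1+x)^ρβ` on `[-1,1]`. -/
noncomputable def widomFactor (ρa ρb : ℝ) (n : ℕ) : ℝ :=
  2 ^ n * sInf (jacobiSup ρa ρb '' {P : Polynomial ℝ | P.Monic ∧ P.natDegree = n})

open Polynomial ComplexConjugate in
/-- A zero-free analytic function on a neighbourhood of the closed unit disc, written as `exp ∘ L`
and real on the real axis, is uniformly close, in ratio, to real polynomials. -/
theorem exists_polynomial_mul_exp_neg_sub_one_le {L : ℂ → ℂ} {R : ℝ} (hR : 1 < R)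
    (hL : DifferentiableOn ℂ L (Metric.closedBall 0 R)) (hL0 : L 0 = 0)
    (hLc : ∀ z : ℂ, ‖z‖ ≤ 1 → L (conj z) = conj (L z)) {ε : ℝ} (hε : 0 < ε) :
    ∃ h : ℝ[X], h.coeff 0 = 1 ∧
      ∀ z : ℂ, ‖z‖ ≤ 1 → ‖aeval z h * Complex.exp (-L z) - 1‖ ≤ ε := by
  have hsub : Metric.closedBall (0 : ℂ) 1 ⊆ Metric.closedBall 0 R :=
    Metric.closedBall_subset_closedBall hR.le
  obtain ⟨C, hC⟩ := (isCompact_closedBall (0 : ℂ) 1).exists_bound_of_continuousOn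
    (f := fun z => Complex.exp (-L z)) ((hL.continuousOn.mono hsub).neg.cexp)
  have hC0 : 0 ≤ C := (norm_nonneg _).trans (hC 0 (by simp))
  have hC1 : 0 < C + 1 := by linarith
  lift R to NNReal using by linarith
  have hR' : (1 : NNReal) < R := by exact_mod_cast hR
  have hF := (hL.cexp).hasFPowerSeriesOnBall (zero_lt_one.trans hR')
  set p := cauchyPowerSeries (fun z => Complex.exp (L z)) 0 (R : ℝ)
  obtain ⟨r', hr1, hrR⟩ := exists_between hR'
  have hT := hF.tendstoUniformlyOn (r' := r') (by exact_mod_cast hrR)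
  rw [Metric.tendstoUniformlyOn_iff] at hT
  obtain ⟨N, hN, hN1⟩ := ((hT (ε / (C + 1)) (by positivity)).and
    (Filter.eventually_ge_atTop 1)).exists
  have hc0 : p.coeff 0 = 1 := by
    have := hF.coeff_zero (fun _ => (0 : ℂ))
    simp [hL0] at this
    simpa using this
  refine ⟨∑ k ∈ Finset.range N, monomial k (p.coeff k).re, ?_, ?_⟩
  · simp only [finsetSum_coeff, coeff_monomial]
    rw [Finset.sum_ite_eq', if_pos (Finset.mem_range.2 hN1), hc0]
    simp
  intro z hz
  have hmem : ∀ w : ℂ, ‖w‖ ≤ 1 → w ∈ Metric.ball (0 : ℂ) r' := fun w hw => by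
    rw [mem_ball_zero_iff]
    exact hw.trans_lt (by exact_mod_cast hr1)
  have hsum : ∀ w : ℂ, p.partialSum N w = ∑ k ∈ Finset.range N, w ^ k * p.coeff k := fun w => by
    simp [FormalMultilinearSeries.partialSum]
  have h1 := hN z (hmem z hz)
  have h2 := hN (conj z) (hmem _ (by simpa using hz))
  simp only [zero_add, dist_eq_norm] at h1 h2
  rw [hLc z hz] at h2
  have h3 : ‖Complex.exp (L z) - conj (p.partialSum N (conj z))‖ < ε / (C + 1) := by
    rw [← Complex.norm_conj]
    simpa [← Complex.exp_conj] using h2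
  have hev : aeval z (∑ k ∈ Finset.range N, monomial k (p.coeff k).re)
      = (p.partialSum N z + conj (p.partialSum N (conj z))) / 2 := by
    rw [hsum, hsum, map_sum, map_sum, ← Finset.sum_add_distrib, Finset.sum_div]
    refine Finset.sum_congr rfl fun k _ => ?_
    rw [aeval_monomial, map_mul, map_pow, Complex.conj_conj, ← mul_add, Complex.add_conj]
    simp
    ring
  have hd : ‖aeval z (∑ k ∈ Finset.range N, monomial k (p.coeff k).re) - Complex.exp (L z)‖
      ≤ ε / (C + 1) := by
    rw [hev, show (p.partialSum N z + conj (p.partialSum N (conj z))) / 2 - Complex.exp (L z)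
      = -((Complex.exp (L z) - p.partialSum N z)
        + (Complex.exp (L z) - conj (p.partialSum N (conj z)))) / 2 by ring]
    rw [norm_div, norm_neg, Complex.norm_two]
    have := norm_add_le (Complex.exp (L z) - p.partialSum N z)
      (Complex.exp (L z) - conj (p.partialSum N (conj z)))
    linarith
  have hone : Complex.exp (L z) * Complex.exp (-L z) = 1 := by
    rw [← Complex.exp_add]; simp
  rw [← hone, ← sub_mul, norm_mul]
  calc _ ≤ ε / (C + 1) * C :=
        mul_le_mul hd (hC z (by simpa using hz)) (norm_nonneg _) (by positivity)
    _ ≤ ε := by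
        rw [div_mul_eq_mul_div, div_le_iff₀ hC1]; nlinarith

/-- A continuous function on `[0, c]` rising from `0` to `n * d` takes the values `k * d`,
`k ≤ n`, at increasing points. -/
theorem exists_strictMono_eq_mul {Φ : ℝ → ℝ} {c d : ℝ} {n : ℕ} (hc : 0 ≤ c) (hd : 0 < d)
    (hΦ : ContinuousOn Φ (Set.Icc 0 c)) (h0 : Φ 0 = 0) (h1 : Φ c = n * d) :
    ∃ θ : ℕ → ℝ, (∀ k ≤ n, θ k ∈ Set.Icc 0 c ∧ Φ (θ k) = k * d) ∧
      ∀ i j, i < j → j ≤ n → θ i < θ j := by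
  suffices H : ∀ m ≤ n, ∃ θ : ℕ → ℝ, (∀ k ≤ m, θ k ∈ Set.Icc 0 c ∧ Φ (θ k) = k * d) ∧
      ∀ i j, i < j → j ≤ m → θ i < θ j from H n le_rfl
  intro m
  induction m with
  | zero =>
    intro _
    refine ⟨fun _ => 0, fun k hk => ?_, fun i j hij hj => by omega⟩
    obtain rfl : k = 0 := by omega
    exact ⟨⟨le_rfl, hc⟩, by simp [h0]⟩
  | succ m ih =>
    intro hm
    obtain ⟨θ, hθ, hlt⟩ := ih (by omega)
    obtain ⟨hmem, hval⟩ := hθ m le_rfl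
    obtain ⟨t, ht, htv⟩ := intermediate_value_Icc hmem.2
      (hΦ.mono (Set.Icc_subset_Icc_left hmem.1))
      (show ((m + 1 : ℕ) : ℝ) * d ∈ Set.Icc (Φ (θ m)) (Φ c) by
        rw [hval, h1]
        refine ⟨?_, ?_⟩ <;> refine mul_le_mul_of_nonneg_right ?_ hd.le
        · simp
        · exact_mod_cast hm)
    have hlast : θ m < t := by
      refine lt_of_le_of_ne ht.1 fun h => ?_
      rw [← h, hval] at htv
      push_cast at htv
      linarith
    refine ⟨fun k => if k ≤ m then θ k else t, fun k hk => ?_, fun i j hij hj => ?_⟩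
    · by_cases h : k ≤ m
      · simpa [h] using hθ k h
      · obtain rfl : k = m + 1 := by omega
        simp only [h, if_false]
        exact ⟨⟨hmem.1.trans ht.1, ht.2⟩, htv⟩
    · by_cases h : j ≤ m
      · simpa [h, show i ≤ m by omega] using hlt i j hij h
      · simp only [h, show i ≤ m by omega, if_true, if_false]
        rcases (show i ≤ m by omega).lt_or_eq with hi | rfl
        · exact (hlt i m hi le_rfl).trans hlast
        · exact hlast

/-- The products of node differences of decreasing nodes alternate in sign. -/
theorem neg_one_pow_mul_prod_erase_sub_pos {v : ℕ → ℝ} {n i : ℕ}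
    (hv : ∀ i j, i < j → j ≤ n → v j < v i) (hi : i ≤ n) :
    0 < (-1) ^ i * ∏ j ∈ (Finset.range (n + 1)).erase i, (v i - v j) := by
  have h₁ : 0 < ∏ j ∈ Finset.range i, ((-1) * (v i - v j)) :=
    Finset.prod_pos fun j hj => mul_pos_of_neg_of_neg neg_one_lt_zero <| sub_neg.mpr <|
      hv j i (Finset.mem_range.mp hj) hi
  rw [Finset.prod_mul_distrib, Finset.prod_const, Finset.card_range] at h₁
  have h₂ : 0 < ∏ j ∈ Finset.Ioc i n, (v i - v j) :=
    Finset.prod_pos fun j hj => sub_pos.mpr <|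
      hv i j (Finset.mem_Ioc.mp hj).1 (Finset.mem_Ioc.mp hj).2
  have union : (Finset.range (n + 1)).erase i = (Finset.range i) ∪ Finset.Ioc i n := by grind
  have disjoint : Disjoint (Finset.range i) (Finset.Ioc i n) := by grind [Finset.disjoint_iff_ne]
  rw [union, Finset.prod_union disjoint, ← mul_assoc]
  exact mul_pos h₁ h₂

open Polynomial in
/-- De la Vallée Poussin's comparison of top coefficients on an alternation set. -/
theorem coeff_le_mul_coeff_of_alternating {P R : ℝ[X]} {n : ℕ} {v w : ℕ → ℝ} {M : ℝ}
    (hv : ∀ i j, i < j → j ≤ n → v j < v i) (hP : P.natDegree ≤ n) (hR : R.natDegree ≤ n)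
    (hRv : ∀ i ≤ n, R.eval (v i) = (-1) ^ i * w i)
    (hPv : ∀ i ≤ n, |P.eval (v i)| ≤ M * w i) : P.coeff n ≤ M * R.coeff n := by
  have hinj : Set.InjOn v (Finset.range (n + 1) : Finset ℕ) := by
    intro i hi j hj hij
    simp only [Finset.coe_range, Set.mem_Iio] at hi hj
    rcases lt_trichotomy i j with h | h | h
    · exact absurd hij (hv i j h (by omega)).ne'
    · exact h
    · exact absurd hij (hv j i h (by omega)).ne
  have hco : ∀ S : ℝ[X], S.natDegree ≤ n → S.coeff n = ∑ i ∈ Finset.range (n + 1),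
      S.eval (v i) / ∏ j ∈ (Finset.range (n + 1)).erase i, (v i - v j) := fun S hS => by
    have := Lagrange.coeff_eq_sum hinj (P := S) (by
      rw [Finset.card_range]
      exact (natDegree_le_iff_degree_le.1 hS).trans_lt (by exact_mod_cast Nat.lt_succ_self n))
    simpa using this
  rw [hco P hP, hco R hR, Finset.mul_sum]
  refine Finset.sum_le_sum fun i hi => ?_
  have hi' : i ≤ n := by simpa [Nat.lt_succ_iff] using hi
  have hpos := neg_one_pow_mul_prod_erase_sub_pos hv hi'
  set π := ∏ j ∈ (Finset.range (n + 1)).erase i, (v i - v j)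
  have h1 := abs_le.1 (hPv i hi')
  rw [hRv i hi']
  rcases neg_one_pow_eq_or ℝ i with h | h <;> rw [h] at hpos ⊢
  · rw [one_mul] at hpos
    rw [one_mul, ← mul_div_assoc]
    exact (div_le_div_iff_of_pos_right hpos).2 h1.2
  · have hneg : π < 0 := by linarith
    rw [← mul_div_assoc]
    exact div_le_div_of_nonpos_of_le hneg.le (by linarith)

open Polynomial in
/-- The polynomial of degree `n` in `cos θ` given by `Re (z ^ n * conj (h z))`, `z = exp (i θ)`. -/
noncomputable def bernsteinSzego (n : ℕ) (h : ℝ[X]) : ℝ[X] :=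
  ∑ k ∈ Finset.range (h.natDegree + 1), C (h.coeff k) * Chebyshev.T ℝ ((n : ℤ) - k)

open Polynomial ComplexConjugate in
theorem bernsteinSzego_eval_cos (n : ℕ) (h : ℝ[X]) (θ : ℝ) :
    (bernsteinSzego n h).eval (Real.cos θ) =
      (Complex.exp (n * θ * Complex.I) * conj (aeval (Complex.exp (θ * Complex.I)) h)).re := by
  rw [bernsteinSzego, eval_finsetSum, aeval_eq_sum_range, map_sum, Finset.mul_sum, Complex.re_sum]
  refine Finset.sum_congr rfl fun k _ => ?_
  rw [eval_mul, eval_C, Chebyshev.T_real_cos, Complex.real_smul, map_mul, Complex.conj_ofReal,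
    map_pow, ← Complex.exp_conj, ← Complex.exp_nat_mul, mul_left_comm, ← Complex.exp_add,
    Complex.re_ofReal_mul,
    show (n : ℂ) * θ * Complex.I + k * conj ((θ : ℂ) * Complex.I)
      = ((((n : ℤ) - k : ℤ) * θ : ℝ) : ℂ) * Complex.I by
        simp; ring,
    Complex.exp_ofReal_mul_I_re]

open Polynomial in
theorem natDegree_bernsteinSzego_le {n : ℕ} {h : ℝ[X]} (hn : h.natDegree < n) :
    (bernsteinSzego n h).natDegree ≤ n := by
  refine natDegree_sum_le_of_forall_le _ _ fun k hk => (natDegree_C_mul_le _ _).trans ?_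
  rw [Chebyshev.natDegree_T]
  have := Finset.mem_range.1 hk
  omega

open Polynomial in
theorem coeff_bernsteinSzego {n : ℕ} {h : ℝ[X]} (hn : h.natDegree < n) :
    (bernsteinSzego n h).coeff n = h.coeff 0 * 2 ^ (n - 1) := by
  rw [bernsteinSzego, finsetSum_coeff, Finset.sum_eq_single 0]
  · have h1 : (Chebyshev.T ℝ (n : ℤ)).natDegree = n := by simp [Chebyshev.natDegree_T]
    have h2 := Chebyshev.leadingCoeff_T ℝ (n : ℤ)
    rw [leadingCoeff, h1] at h2
    simp [h2]
  · intro k hk hk0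
    have := Finset.mem_range.1 hk
    refine (coeff_C_mul _).trans (mul_eq_zero_of_right _ (coeff_eq_zero_of_natDegree_lt ?_))
    rw [Chebyshev.natDegree_T]
    omega
  · simp

open Polynomial ComplexConjugate in
/-- Lower bound for the weighted sup norm of a monic polynomial, with weight `1 / |h|` for `h`
zero-free in the closed unit disc. -/
theorem two_le_two_pow_mul_of_abs_eval_cos_le {L : ℂ → ℂ} {h : ℝ[X]}
    (hL : ContinuousOn L (Metric.closedBall 0 1))
    (hLc : ∀ z : ℂ, ‖z‖ ≤ 1 → L (conj z) = conj (L z)) (hh0 : h.coeff 0 = 1)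
    (hh : ∀ z : ℂ, ‖z‖ ≤ 1 → ‖aeval z h * Complex.exp (-L z) - 1‖ < 1)
    {n : ℕ} (hn : h.natDegree < n) {P : ℝ[X]} (hP : P.Monic) (hPn : P.natDegree = n) {M : ℝ}
    (hM : ∀ θ : ℝ, |P.eval (Real.cos θ)| ≤ M * ‖aeval (Complex.exp (θ * Complex.I)) h‖) :
    2 ≤ 2 ^ n * M := by
  set u : ℂ → ℂ := fun z => aeval z h * Complex.exp (-L z) with hu
  have hus : ∀ z : ℂ, ‖z‖ ≤ 1 → u z ∈ Complex.slitPlane := fun z hz => by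
    have := Complex.mem_slitPlane_of_norm_lt_one (hh z hz)
    simpa using this
  have haec : ∀ z : ℂ, aeval (conj z) h = conj (aeval z h) := fun z => by
    simp [aeval_eq_sum_range]
  have huc : ∀ z : ℂ, ‖z‖ ≤ 1 → u (conj z) = conj (u z) := fun z hz => by
    simp only [hu]
    rw [haec, hLc z hz, map_mul, ← Complex.exp_conj, map_neg]
  set Λ : ℂ → ℂ := fun z => L z + Complex.log (u z) with hΛ
  have hΛc : ContinuousOn Λ (Metric.closedBall 0 1) := by
    refine hL.add (ContinuousOn.clog ?_ fun z hz => hus z (by simpa using hz))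
    exact (h.continuous_aeval).continuousOn.mul hL.neg.cexp
  have hΛim : ∀ x : ℝ, |x| ≤ 1 → (Λ x).im = 0 := fun x hx => by
    have hx' : ‖(x : ℂ)‖ ≤ 1 := by simpa using hx
    rw [← Complex.conj_eq_iff_im]
    simp only [hΛ]
    rw [map_add, ← hLc _ hx', ← Complex.log_conj _ (Complex.slitPlane_arg_ne_pi (hus _ hx')),
      ← huc _ hx', Complex.conj_ofReal]
  have hexp : ∀ z : ℂ, ‖z‖ ≤ 1 → aeval z h = Complex.exp (Λ z) := fun z hz => by
    simp only [hΛ]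
    rw [Complex.exp_add, Complex.exp_log (Complex.slitPlane_ne_zero (hus z hz))]
    simp only [hu]
    rw [mul_left_comm, ← Complex.exp_add]
    simp
  have hcirc : ∀ θ : ℝ, ‖Complex.exp (θ * Complex.I)‖ ≤ 1 := fun θ =>
    (Complex.norm_exp_ofReal_mul_I θ).le
  set Φ : ℝ → ℝ := fun θ => n * θ - (Λ (Complex.exp (θ * Complex.I))).im with hΦ
  have hΦc : Continuous Φ := by
    have h1 : Continuous fun θ : ℝ => Λ (Complex.exp (θ * Complex.I)) :=
      hΛc.comp_continuous (by fun_prop) fun θ => by simp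
    exact (by fun_prop : Continuous fun θ : ℝ => (n : ℝ) * θ).sub (Complex.continuous_im.comp h1)
  have hev : ∀ θ : ℝ, (bernsteinSzego n h).eval (Real.cos θ) =
      Real.cos (Φ θ) * ‖aeval (Complex.exp (θ * Complex.I)) h‖ := fun θ => by
    rw [bernsteinSzego_eval_cos, hexp _ (hcirc θ), ← Complex.exp_conj, ← Complex.exp_add,
      Complex.exp_re, Complex.norm_exp, mul_comm]
    congr 2
    · simp [hΦ, sub_eq_add_neg]
    · simp
  obtain ⟨θ, hθ, hlt⟩ := exists_strictMono_eq_mul (n := n) Real.pi_pos.le Real.pi_pos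
    hΦc.continuousOn (by simpa [hΦ] using hΛim 1 (by simp))
    (by simpa [hΦ] using hΛim (-1) (by simp))
  have hkey := coeff_le_mul_coeff_of_alternating (P := P) (R := bernsteinSzego n h) (n := n)
    (v := fun k => Real.cos (θ k)) (w := fun k => ‖aeval (Complex.exp (θ k * Complex.I)) h‖)
    (M := M)
    (fun i j hij hj => Real.strictAntiOn_cos (hθ i (by omega)).1 (hθ j hj).1 (hlt i j hij hj))
    hPn.le (natDegree_bernsteinSzego_le hn)
    (fun i hi => by rw [hev, (hθ i hi).2, Real.cos_nat_mul_pi])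
    (fun i _ => hM _)
  rw [coeff_bernsteinSzego hn, hh0, ← hPn, coeff_natDegree, hP.leadingCoeff, hPn] at hkey
  obtain ⟨m, rfl⟩ : ∃ m, n = m + 1 := ⟨n - 1, by omega⟩
  rw [pow_succ]
  simp only [add_tsub_cancel_right] at hkey
  linarith

/-- A logarithm of `(1 - r z) ^ (2 p) * (1 + r z) ^ (2 q)`. -/
noncomputable def jacobiLog (p q r : ℝ) (z : ℂ) : ℂ :=
  2 * p * Complex.log (1 - r * z) + 2 * q * Complex.log (1 + r * z)

theorem one_add_mul_mem_slitPlane {r : ℝ} {z : ℂ} (h : |r| * ‖z‖ < 1) :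
    1 + r * z ∈ Complex.slitPlane :=
  Complex.mem_slitPlane_of_norm_lt_one (by simpa using h)

theorem one_sub_mul_mem_slitPlane {r : ℝ} {z : ℂ} (h : |r| * ‖z‖ < 1) :
    1 - r * z ∈ Complex.slitPlane := by
  have := one_add_mul_mem_slitPlane (r := -r) (z := z) (by simpa using h)
  simpa [sub_eq_add_neg] using this

theorem differentiableOn_jacobiLog {p q r R : ℝ} (h : |r| * R < 1) :
    DifferentiableOn ℂ (jacobiLog p q r) (Metric.closedBall 0 R) := by
  have hlt : ∀ z ∈ Metric.closedBall (0 : ℂ) R, |r| * ‖z‖ < 1 := fun z hz =>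
    (mul_le_mul_of_nonneg_left (by simpa using hz) (abs_nonneg r)).trans_lt h
  unfold jacobiLog
  refine DifferentiableOn.add ?_ ?_
  · exact (DifferentiableOn.clog (by fun_prop)
      fun z hz => one_sub_mul_mem_slitPlane (hlt z hz)).const_mul _
  · exact (DifferentiableOn.clog (by fun_prop)
      fun z hz => one_add_mul_mem_slitPlane (hlt z hz)).const_mul _

open ComplexConjugate in
theorem jacobiLog_conj {p q r : ℝ} {z : ℂ} (h : |r| * ‖z‖ < 1) :
    jacobiLog p q r (conj z) = conj (jacobiLog p q r z) := by
  have h1 := Complex.log_conj _ (Complex.slitPlane_arg_ne_pi (one_sub_mul_mem_slitPlane h))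
  have h2 := Complex.log_conj _ (Complex.slitPlane_arg_ne_pi (one_add_mul_mem_slitPlane h))
  simp only [map_sub, map_add, map_mul, map_one, Complex.conj_ofReal] at h1 h2
  have h3 : conj (2 : ℂ) = 2 := Complex.conj_ofNat 2
  simp [jacobiLog, h1, h2, h3]

theorem norm_exp_jacobiLog {p q r : ℝ} (hr : |r| < 1) (θ : ℝ) :
    ‖Complex.exp (jacobiLog p q r (Complex.exp (θ * Complex.I)))‖ =
      (1 - 2 * r * Real.cos θ + r ^ 2) ^ p * (1 + 2 * r * Real.cos θ + r ^ 2) ^ q := by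
  have key : ∀ s : ℝ, |s| < 1 → ‖1 + s * Complex.exp (θ * Complex.I)‖ ^ 2 =
      1 + 2 * s * Real.cos θ + s ^ 2 ∧ 0 < ‖1 + s * Complex.exp (θ * Complex.I)‖ := by
    intro s hs
    refine ⟨?_, norm_pos_iff.2 (Complex.slitPlane_ne_zero (one_add_mul_mem_slitPlane ?_))⟩
    · rw [Complex.sq_norm, Complex.normSq_apply]
      simp [Complex.exp_ofReal_mul_I_re, Complex.exp_ofReal_mul_I_im]
      linear_combination s ^ 2 * Real.sin_sq_add_cos_sq θ
    · rwa [Complex.norm_exp_ofReal_mul_I, mul_one]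
  obtain ⟨h1, h1'⟩ := key r hr
  obtain ⟨h2, h2'⟩ := key (-r) (by simpa using hr)
  have e2 : (1 : ℂ) + ((-r : ℝ) : ℂ) * Complex.exp (θ * Complex.I)
      = 1 - r * Complex.exp (θ * Complex.I) := by push_cast; ring
  rw [e2] at h2 h2'
  rw [show 1 - 2 * r * Real.cos θ + r ^ 2 = 1 + 2 * -r * Real.cos θ + (-r) ^ 2 by ring,
    ← h1, ← h2, ← Real.rpow_natCast_mul h1'.le, ← Real.rpow_natCast_mul h2'.le,
    Real.rpow_def_of_pos h1', Real.rpow_def_of_pos h2', ← Real.exp_add, Complex.norm_exp]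
  congr 1
  have : ∀ (c : ℝ) (z : ℂ), (2 * (c : ℂ) * z).re = 2 * c * z.re := fun c z => by
    simp
  rw [jacobiLog, Complex.add_re, this, this, Complex.log_re, Complex.log_re]
  push_cast
  ring

open Polynomial in
/-- Real polynomials whose modulus on the unit circle approximates that of
`(1 - r z) ^ (2 p) * (1 + r z) ^ (2 q)`. -/
theorem exists_polynomial_norm_approx (p q : ℝ) {r ε : ℝ} (hr0 : 0 < r) (hr : r < 1)
    (hε : 0 < ε) :
    ∃ h : ℝ[X], h.coeff 0 = 1 ∧
      (∀ z : ℂ, ‖z‖ ≤ 1 → ‖aeval z h * Complex.exp (-jacobiLog p q r z) - 1‖ ≤ ε) ∧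
      ∀ θ : ℝ,
        ‖aeval (Complex.exp (θ * Complex.I)) h‖ ≤ (1 + ε) *
          ((1 - 2 * r * Real.cos θ + r ^ 2) ^ p * (1 + 2 * r * Real.cos θ + r ^ 2) ^ q) ∧
        (1 - ε) * ((1 - 2 * r * Real.cos θ + r ^ 2) ^ p * (1 + 2 * r * Real.cos θ + r ^ 2) ^ q)
          ≤ ‖aeval (Complex.exp (θ * Complex.I)) h‖ := by
  have habs : |r| = r := abs_of_pos hr0
  obtain ⟨R, hR1, hR⟩ := exists_between ((one_lt_inv₀ hr0).2 hr)
  have hrR : |r| * R < 1 := by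
    rw [habs]
    calc r * R < r * r⁻¹ := by gcongr
      _ = 1 := mul_inv_cancel₀ hr0.ne'
  obtain ⟨h, h0, hh⟩ := exists_polynomial_mul_exp_neg_sub_one_le (L := jacobiLog p q r) hR1
    (differentiableOn_jacobiLog hrR) (by simp [jacobiLog])
    (fun z hz => jacobiLog_conj (by rw [habs]; nlinarith [norm_nonneg z])) hε
  refine ⟨h, h0, hh, fun θ => ?_⟩
  rw [← norm_exp_jacobiLog (by rwa [habs])]
  set z := Complex.exp (θ * Complex.I)
  have hz := hh z (Complex.norm_exp_ofReal_mul_I θ).le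
  set u := aeval z h * Complex.exp (-jacobiLog p q r z) with hu
  have hfac : aeval z h = u * Complex.exp (jacobiLog p q r z) := by
    rw [hu, mul_assoc, ← Complex.exp_add]; simp
  rw [hfac, norm_mul]
  have h1 := norm_sub_norm_le u 1
  have h2 := norm_sub_norm_le 1 u
  rw [norm_one] at h1 h2
  rw [norm_sub_rev] at h2
  constructor <;> refine mul_le_mul_of_nonneg_right ?_ (norm_nonneg _) <;> linarith

theorem one_sub_cos_le {r : ℝ} (hr : 0 < r) (θ : ℝ) :
    1 - Real.cos θ ≤ 2 / (1 + r) ^ 2 * (1 - 2 * r * Real.cos θ + r ^ 2) := by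
  rw [div_mul_eq_mul_div, le_div_iff₀ (by positivity)]
  nlinarith [mul_nonneg (sq_nonneg (1 - r)) (neg_le_iff_add_nonneg'.1 (Real.neg_one_le_cos θ))]

theorem one_add_cos_le {r : ℝ} (hr : 0 < r) (θ : ℝ) :
    1 + Real.cos θ ≤ 2 / (1 + r) ^ 2 * (1 + 2 * r * Real.cos θ + r ^ 2) := by
  have := one_sub_cos_le hr (Real.pi - θ)
  rw [Real.cos_pi_sub] at this
  linarith

theorem one_sub_two_mul_cos_pos {r : ℝ} (hr : r < 1) (hr0 : 0 < r) (θ : ℝ) :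
    0 < 1 - 2 * r * Real.cos θ + r ^ 2 := by
  nlinarith [Real.cos_le_one θ, sq_pos_of_pos (sub_pos.2 hr)]

theorem one_add_two_mul_cos_pos {r : ℝ} (hr : r < 1) (hr0 : 0 < r) (θ : ℝ) :
    0 < 1 + 2 * r * Real.cos θ + r ^ 2 := by
  nlinarith [Real.neg_one_le_cos θ, sq_pos_of_pos (sub_pos.2 hr)]

theorem jacobiWeight_cos_le {a b r : ℝ} (ha : 0 ≤ a) (hb : 0 ≤ b) (hr : r < 1) (hr0 : 0 < r)
    (θ : ℝ) :
    (1 - Real.cos θ) ^ a * (1 + Real.cos θ) ^ b ≤ (2 / (1 + r) ^ 2) ^ (a + b) *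
      ((1 - 2 * r * Real.cos θ + r ^ 2) ^ a * (1 + 2 * r * Real.cos θ + r ^ 2) ^ b) := by
  have hκ : 0 < 2 / (1 + r) ^ 2 := by positivity
  have h1 := one_sub_two_mul_cos_pos hr hr0 θ
  have h2 := one_add_two_mul_cos_pos hr hr0 θ
  have h3 : 0 ≤ 1 - Real.cos θ := sub_nonneg.2 (Real.cos_le_one θ)
  have h4 : 0 ≤ 1 + Real.cos θ := by linarith [Real.neg_one_le_cos θ]
  calc _ ≤ (2 / (1 + r) ^ 2 * (1 - 2 * r * Real.cos θ + r ^ 2)) ^ a *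
        (2 / (1 + r) ^ 2 * (1 + 2 * r * Real.cos θ + r ^ 2)) ^ b :=
        mul_le_mul (Real.rpow_le_rpow h3 (one_sub_cos_le hr0 θ) ha)
          (Real.rpow_le_rpow h4 (one_add_cos_le hr0 θ) hb) (by positivity) (by positivity)
    _ = _ := by
        rw [Real.mul_rpow hκ.le h1.le, Real.mul_rpow hκ.le h2.le, Real.rpow_add hκ]
        ring

theorem bddAbove_jacobiWeight_mul_abs_eval {a b : ℝ} (ha : 0 ≤ a) (hb : 0 ≤ b)
    (P : Polynomial ℝ) : BddAbove ((fun x : ℝ => (1 - x) ^ a * (1 + x) ^ b * |P.eval x|) ''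
      Set.Icc (-1 : ℝ) 1) := by
  refine (isCompact_Icc.image_of_continuousOn (Continuous.continuousOn ?_)).bddAbove
  exact (((by fun_prop : Continuous fun x : ℝ => 1 - x).rpow_const fun _ => Or.inr ha).mul
    ((by fun_prop : Continuous fun x : ℝ => 1 + x).rpow_const fun _ => Or.inr hb)).mul
    P.continuous.abs

theorem jacobiSup_nonneg (a b : ℝ) (P : Polynomial ℝ) : 0 ≤ jacobiSup a b P := by
  refine Real.sSup_nonneg ?_
  rintro _ ⟨x, hx, rfl⟩
  have h1 : 0 ≤ 1 - x := sub_nonneg.2 hx.2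
  have h2 : 0 ≤ 1 + x := by linarith [hx.1]
  positivity

open Polynomial in
theorem eventually_widomFactor_le {a b r ε : ℝ} (ha : 0 ≤ a) (hb : 0 ≤ b) (hr0 : 0 < r)
    (hr : r < 1) (hε : 0 < ε) :
    ∀ᶠ n in atTop, widomFactor a b n ≤ 2 * ((2 / (1 + r) ^ 2) ^ (a + b) * (1 + ε)) := by
  obtain ⟨h, h0, -, hh⟩ := exists_polynomial_norm_approx (-a) (-b) hr0 hr hε
  filter_upwards [eventually_gt_atTop h.natDegree] with n hn
  obtain ⟨m, rfl⟩ : ∃ m, n = m + 1 := ⟨n - 1, by omega⟩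
  have hdeg := natDegree_bernsteinSzego_le hn
  have hco := coeff_bernsteinSzego hn
  rw [h0, one_mul, Nat.add_sub_cancel] at hco
  set S := bernsteinSzego (m + 1) h with hS
  have hSd : S.natDegree = m + 1 :=
    le_antisymm hdeg (le_natDegree_of_ne_zero (by rw [hco]; positivity))
  set P := C ((2 ^ m)⁻¹ : ℝ) * S with hP
  have hPm : P.Monic := by
    rw [Monic, hP, leadingCoeff_mul, leadingCoeff_C, leadingCoeff, hSd, hco]
    exact inv_mul_cancel₀ (by positivity)
  have hPd : P.natDegree = m + 1 := by
    rw [hP, natDegree_C_mul (by positivity), hSd]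
  have hsup : jacobiSup a b P ≤ (2 ^ m)⁻¹ * ((2 / (1 + r) ^ 2) ^ (a + b) * (1 + ε)) := by
    refine csSup_le ((Set.nonempty_Icc.2 (by norm_num)).image _) ?_
    rintro _ ⟨x, hx, rfl⟩
    rw [← Real.cos_arccos hx.1 hx.2]
    set θ := Real.arccos x
    have hw := jacobiWeight_cos_le ha hb hr hr0 θ
    have h1 := one_sub_two_mul_cos_pos hr hr0 θ
    have h2 := one_add_two_mul_cos_pos hr hr0 θ
    have hSle : |S.eval (Real.cos θ)| ≤ (1 + ε) * ((1 - 2 * r * Real.cos θ + r ^ 2) ^ (-a)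
        * (1 + 2 * r * Real.cos θ + r ^ 2) ^ (-b)) := by
      refine le_trans ?_ (hh θ).1
      rw [hS, bernsteinSzego_eval_cos]
      refine (Complex.abs_re_le_norm _).trans ?_
      rw [norm_mul, Complex.norm_conj, Complex.norm_exp]
      simp
    simp only [hP, eval_mul, eval_C, abs_mul]
    rw [abs_of_pos (by positivity : (0 : ℝ) < (2 ^ m)⁻¹), mul_left_comm]
    refine mul_le_mul_of_nonneg_left ?_ (by positivity)
    calc _ ≤ _ := mul_le_mul hw hSle (abs_nonneg _) (by positivity)
      _ = _ := by
        rw [Real.rpow_neg h1.le, Real.rpow_neg h2.le]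
        field_simp
  have hinf : sInf (jacobiSup a b '' {P : ℝ[X] | P.Monic ∧ P.natDegree = m + 1})
      ≤ jacobiSup a b P :=
    csInf_le ⟨0, by rintro _ ⟨Q, -, rfl⟩; exact jacobiSup_nonneg a b Q⟩ ⟨P, ⟨hPm, hPd⟩, rfl⟩
  calc widomFactor a b (m + 1) ≤ 2 ^ (m + 1) *
        ((2 ^ m)⁻¹ * ((2 / (1 + r) ^ 2) ^ (a + b) * (1 + ε))) :=
        mul_le_mul_of_nonneg_left (hinf.trans hsup) (by positivity)
    _ = _ := by
        rw [pow_succ]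
        field_simp

open Polynomial in
theorem eventually_le_widomFactor {a b r ε : ℝ} {N K : ℕ} (ha : 0 ≤ a) (hb : 0 ≤ b)
    (hN : a ≤ N) (hK : b ≤ K) (hr0 : 0 < r) (hr : r < 1) (hε : 0 < ε) (hε1 : ε < 1) :
    ∀ᶠ n in atTop, 2 * (1 - ε) / (2 ^ (N + K) * (2 / (1 + r) ^ 2) ^ ((N - a) + (K - b)))
      ≤ widomFactor a b n := by
  have hs : 0 ≤ N - a := sub_nonneg.2 hN
  have ht : 0 ≤ K - b := sub_nonneg.2 hK
  obtain ⟨h, h0, hu, hh⟩ := exists_polynomial_norm_approx (N - a) (K - b) hr0 hr hε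
  have habs : |r| = r := abs_of_pos hr0
  filter_upwards [eventually_gt_atTop h.natDegree] with n hn
  set κ := (2 / (1 + r) ^ 2) ^ ((N - a) + (K - b))
  have hκ0 : 0 < κ := by positivity
  have hε' : 0 < 1 - ε := by linarith
  rw [widomFactor, ← div_le_iff₀' (by positivity)]
  refine le_csInf (Set.Nonempty.image _ ⟨X ^ n, monic_X_pow n, natDegree_X_pow n⟩) ?_
  rintro _ ⟨P, ⟨hPm, hPd⟩, rfl⟩
  have hA : (X - C (1 : ℝ)).Monic := monic_X_sub_C 1
  have hB : (X + C (1 : ℝ)).Monic := monic_X_add_C 1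
  set Q := (X - C (1 : ℝ)) ^ N * (X + C 1) ^ K * P with hQ
  have hQm : Q.Monic := ((hA.pow N).mul (hB.pow K)).mul hPm
  have hQd : Q.natDegree = N + K + n := by
    rw [hQ, ((hA.pow N).mul (hB.pow K)).natDegree_mul hPm, (hA.pow N).natDegree_mul (hB.pow K),
      hA.natDegree_pow, hB.natDegree_pow, natDegree_X_sub_C, natDegree_X_add_C, hPd]
    simp
  have hbound : ∀ θ : ℝ, |Q.eval (Real.cos θ)| ≤
      jacobiSup a b P * κ / (1 - ε) * ‖aeval (Complex.exp (θ * Complex.I)) h‖ := fun θ => by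
    have h1 : 0 ≤ 1 - Real.cos θ := sub_nonneg.2 (Real.cos_le_one θ)
    have h2 : 0 ≤ 1 + Real.cos θ := by linarith [Real.neg_one_le_cos θ]
    have hle : (1 - Real.cos θ) ^ a * (1 + Real.cos θ) ^ b * |P.eval (Real.cos θ)|
        ≤ jacobiSup a b P :=
      le_csSup (bddAbove_jacobiWeight_mul_abs_eval ha hb P)
        ⟨Real.cos θ, ⟨Real.neg_one_le_cos θ, Real.cos_le_one θ⟩, rfl⟩
    have hw := jacobiWeight_cos_le hs ht hr hr0 θ
    have e1 : (1 - Real.cos θ) ^ N = (1 - Real.cos θ) ^ a * (1 - Real.cos θ) ^ (N - a) := by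
      rw [← Real.rpow_add_of_nonneg h1 ha hs, add_sub_cancel, Real.rpow_natCast]
    have e2 : (1 + Real.cos θ) ^ K = (1 + Real.cos θ) ^ b * (1 + Real.cos θ) ^ (K - b) := by
      rw [← Real.rpow_add_of_nonneg h2 hb ht, add_sub_cancel, Real.rpow_natCast]
    have eQ : |Q.eval (Real.cos θ)| = (1 - Real.cos θ) ^ N * (1 + Real.cos θ) ^ K *
        |P.eval (Real.cos θ)| := by
      simp only [hQ, eval_mul, eval_pow, eval_sub, eval_add, eval_X, eval_C, abs_mul, abs_pow]
      rw [abs_sub_comm, abs_of_nonneg h1, add_comm (Real.cos θ), abs_of_nonneg h2]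
    calc |Q.eval (Real.cos θ)|
        = ((1 - Real.cos θ) ^ a * (1 + Real.cos θ) ^ b * |P.eval (Real.cos θ)|) *
          ((1 - Real.cos θ) ^ (N - a) * (1 + Real.cos θ) ^ (K - b)) := by
          rw [eQ, e1, e2]; ring
      _ ≤ jacobiSup a b P * (κ * ((1 - 2 * r * Real.cos θ + r ^ 2) ^ (N - a) *
          (1 + 2 * r * Real.cos θ + r ^ 2) ^ (K - b))) :=
          mul_le_mul hle hw (by positivity) (jacobiSup_nonneg a b P)
      _ = jacobiSup a b P * κ / (1 - ε) * ((1 - ε) * ((1 - 2 * r * Real.cos θ + r ^ 2) ^ (N - a) *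
          (1 + 2 * r * Real.cos θ + r ^ 2) ^ (K - b))) := by
          field_simp
      _ ≤ _ := mul_le_mul_of_nonneg_left (hh θ).2
          (div_nonneg (mul_nonneg (jacobiSup_nonneg a b P) hκ0.le) hε'.le)
  have hfin := two_le_two_pow_mul_of_abs_eval_cos_le (L := jacobiLog (N - a) (K - b) r)
    (differentiableOn_jacobiLog (by rwa [habs, mul_one])).continuousOn
    (fun z hz => jacobiLog_conj (by rw [habs]; nlinarith [norm_nonneg z])) h0
    (fun z hz => (hu z hz).trans_lt hε1) (n := N + K + n) (by omega) hQm hQd hbound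
  rw [div_div, div_le_iff₀ (by positivity)]
  rw [pow_add, mul_div_assoc', le_div_iff₀ hε'] at hfin
  linarith

theorem widomFactor_tendsto (ρa ρb : ℝ) (hρa : 0 ≤ ρa) (hρb : 0 ≤ ρb) :
    Tendsto (fun n : ℕ => widomFactor ρa ρb n) atTop
      (nhds ((2 : ℝ) ^ (1 - ρa - ρb))) := by
  have hε : ∀ᶠ ε : ℝ in nhdsWithin 0 (Set.Ioi 0), 0 < ε ∧ ε < 1 :=
    Ioo_mem_nhdsGT one_pos
  have hκ : ∀ s : ℝ, 0 ≤ s → ContinuousAt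
      (fun ε : ℝ => (2 / (1 + (1 - ε)) ^ 2 : ℝ) ^ s) 0 := fun s hs =>
    ContinuousAt.rpow_const
      (ContinuousAt.div continuousAt_const (by fun_prop) (by norm_num)) (Or.inr hs)
  have hhalf : (2 / (1 + (1 - 0)) ^ 2 : ℝ) = 2⁻¹ := by norm_num
  have h2 : (0 : ℝ) < 2 := two_pos
  refine tendsto_order.2 ⟨fun l hl => ?_, fun l hl => ?_⟩
  · have hs : 0 ≤ (⌈ρa⌉₊ - ρa) + (⌈ρb⌉₊ - ρb) :=
      add_nonneg (sub_nonneg.2 (Nat.le_ceil ρa)) (sub_nonneg.2 (Nat.le_ceil ρb))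
    have hc : ContinuousAt (fun ε : ℝ => 2 * (1 - ε) / (2 ^ (⌈ρa⌉₊ + ⌈ρb⌉₊) *
        (2 / (1 + (1 - ε)) ^ 2 : ℝ) ^ ((⌈ρa⌉₊ - ρa) + (⌈ρb⌉₊ - ρb)))) 0 :=
      ContinuousAt.div (by fun_prop) (continuousAt_const.mul (hκ _ hs))
        (by rw [hhalf]; positivity)
    have hval : 2 * (1 - 0) / (2 ^ (⌈ρa⌉₊ + ⌈ρb⌉₊) *
        (2 / (1 + (1 - 0)) ^ 2 : ℝ) ^ ((⌈ρa⌉₊ - ρa) + (⌈ρb⌉₊ - ρb)))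
        = (2 : ℝ) ^ (1 - ρa - ρb) := by
      rw [hhalf, Real.inv_rpow h2.le, ← Real.rpow_neg h2.le, ← Real.rpow_natCast 2,
        ← Real.rpow_add h2, sub_zero, mul_one, sub_sub, Real.rpow_sub h2, Real.rpow_one]
      push_cast
      congr 2
      ring
    obtain ⟨ε, hεl, hε0, hε1⟩ := (((hc.tendsto.mono_left nhdsWithin_le_nhds).eventually_const_lt
      (by rw [hval]; exact hl)).and hε).exists
    filter_upwards [eventually_le_widomFactor hρa hρb (Nat.le_ceil ρa) (Nat.le_ceil ρb)
      (sub_pos.2 hε1) (sub_lt_self 1 hε0) hε0 hε1] with n hn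
    exact hεl.trans_le hn
  · have hc : ContinuousAt (fun ε : ℝ => 2 * ((2 / (1 + (1 - ε)) ^ 2 : ℝ) ^ (ρa + ρb) *
        (1 + ε))) 0 :=
      continuousAt_const.mul ((hκ _ (add_nonneg hρa hρb)).mul (by fun_prop))
    have hval : 2 * ((2 / (1 + (1 - 0)) ^ 2 : ℝ) ^ (ρa + ρb) * (1 + 0))
        = (2 : ℝ) ^ (1 - ρa - ρb) := by
      rw [hhalf, Real.inv_rpow h2.le, sub_sub, Real.rpow_sub h2, Real.rpow_one]
      ring
    obtain ⟨ε, hεl, hε0, hε1⟩ := (((hc.tendsto.mono_left nhdsWithin_le_nhds).eventually_lt_const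
      (by rw [hval]; exact hl)).and hε).exists
    filter_upwards [eventually_widomFactor_le hρa hρb (sub_pos.2 hε1) (sub_lt_self 1 hε0) hε0]
      with n hn
    exact hn.trans_lt hεl
end

section
/- If ρ_α, ρ_β ∈ [0, 1/2], then 𝒲_n(ρ_α,ρ_β) ≤ 2^{1-ρ_α-ρ_β} for every n ≥ 1, and sup_{n ≥ 1} 𝒲_n(ρ_α,ρ_β) = 2^{1-ρ_α-ρ_β}. -/
open Polynomial MeasureTheory Set

/-- The Jacobi weight `(1-x)^a (1+x)^b`. -/
noncomputable def jacobiWeight (a b x : ℝ) : ℝ := (1 - x) ^ a * (1 + x) ^ b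

lemma jacobiWeight_neg (a b x : ℝ) : jacobiWeight a b (-x) = jacobiWeight b a x := by
  simp only [jacobiWeight, sub_neg_eq_add, ← sub_eq_add_neg, mul_comm]

lemma intervalIntegrable_jacobiWeight_left {a : ℝ} (b : ℝ) (ha : -1 < a) :
    IntervalIntegrable (jacobiWeight a b) volume 0 1 := by
  have h1 : IntervalIntegrable (fun x : ℝ => (1 - x) ^ a) volume 0 1 := by
    have := (intervalIntegral.intervalIntegrable_rpow' (a := 1) (b := 0) ha).comp_sub_left 1
    simpa using this
  refine h1.mul_continuousOn ?_
  rw [uIcc_of_le zero_le_one]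
  exact (continuousOn_const.add continuousOn_id).rpow_const
    fun x hx => Or.inl (ne_of_gt (show (0 : ℝ) < 1 + x by linarith [hx.1]))

lemma intervalIntegrable_jacobiWeight {a b : ℝ} (ha : -1 < a) (hb : -1 < b) :
    IntervalIntegrable (jacobiWeight a b) volume (-1) 1 := by
  refine IntervalIntegrable.trans (b := 0) ?_ (intervalIntegrable_jacobiWeight_left b ha)
  have := (intervalIntegrable_jacobiWeight_left a hb).comp_sub_left 0
  simp only [zero_sub, jacobiWeight_neg, neg_zero] at this
  exact this.symm

lemma intervalIntegrable_jacobiWeight_mul {a b : ℝ} (ha : -1 < a) (hb : -1 < b) {f : ℝ → ℝ}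
    (hf : Continuous f) :
    IntervalIntegrable (fun x => jacobiWeight a b x * f x) volume (-1) 1 :=
  (intervalIntegrable_jacobiWeight ha hb).mul_continuousOn hf.continuousOn

lemma jacobiWeight_add_one {a b x : ℝ} (ha : -1 < a) (hb : -1 < b) (hx : x ∈ Icc (-1 : ℝ) 1) :
    jacobiWeight (a + 1) (b + 1) x = jacobiWeight a b x * (1 - x ^ 2) := by
  simp only [jacobiWeight]
  rw [Real.rpow_add_one' (by linarith [hx.2]) (by linarith),
    Real.rpow_add_one' (by linarith [hx.1]) (by linarith)]
  ring

lemma hasDerivAt_jacobiWeight (a b : ℝ) {x : ℝ} (hx : x ∈ Ioo (-1 : ℝ) 1) :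
    HasDerivAt (jacobiWeight (a + 1) (b + 1))
      (jacobiWeight a b x * ((b + 1) * (1 - x) - (a + 1) * (1 + x))) x := by
  have h1 : 0 < 1 - x := by linarith [hx.2]
  have h2 : 0 < 1 + x := by linarith [hx.1]
  have d1 := ((hasDerivAt_id x).const_sub 1).rpow_const (p := a + 1) (Or.inl h1.ne')
  have d2 := ((hasDerivAt_id x).const_add 1).rpow_const (p := b + 1) (Or.inl h2.ne')
  refine (d1.mul d2).congr_deriv ?_
  simp only [jacobiWeight, id, add_sub_cancel_right, Real.rpow_add_one h1.ne',
    Real.rpow_add_one h2.ne']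
  ring

lemma continuous_jacobiWeight {a b : ℝ} (ha : 0 ≤ a) (hb : 0 ≤ b) :
    Continuous (jacobiWeight a b) :=
  ((Real.continuous_rpow_const ha).comp (continuous_const.sub continuous_id)).mul
    ((Real.continuous_rpow_const hb).comp (continuous_const.add continuous_id))

/-- Integration by parts against the Jacobi weight. -/
lemma integral_jacobiWeight_mul_pearson {a b : ℝ} (ha : -1 < a) (hb : -1 < b) (Q : ℝ[X]) :
    ∫ x in (-1 : ℝ)..1, jacobiWeight a b x *
      ((1 - x ^ 2) * Q.derivative.eval x + (b - a - (a + b + 2) * x) * Q.eval x) = 0 := by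
  have key := intervalIntegral.integral_eq_sub_of_hasDerivAt_of_le (a := (-1 : ℝ)) (b := 1)
    (f := fun x => jacobiWeight (a + 1) (b + 1) x * Q.eval x)
    (f' := fun x => jacobiWeight a b x *
      ((1 - x ^ 2) * Q.derivative.eval x + (b - a - (a + b + 2) * x) * Q.eval x)) (by norm_num)
    (((continuous_jacobiWeight (by linarith) (by linarith)).mul Q.continuous).continuousOn)
    (fun x hx => by
      refine ((hasDerivAt_jacobiWeight a b hx).mul (Q.hasDerivAt x)).congr_deriv ?_
      rw [jacobiWeight_add_one ha hb (Ioo_subset_Icc_self hx)]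
      ring)
    (intervalIntegrable_jacobiWeight_mul ha hb (by fun_prop))
  rw [key]
  have : a + 1 ≠ 0 := by linarith
  have : b + 1 ≠ 0 := by linarith
  simp [jacobiWeight, *]

lemma integral_eq_mul_of_pearson {a b : ℝ} (ha : -1 < a) (hb : -1 < b) (Q : ℝ[X]) {c d : ℝ}
    {f p : ℝ → ℝ} (hp : Continuous p)
    (h : ∀ x ∈ Icc (-1 : ℝ) 1, f x = jacobiWeight a b x * (c * p x +
      d * ((1 - x ^ 2) * Q.derivative.eval x + (b - a - (a + b + 2) * x) * Q.eval x))) :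
    ∫ x in (-1 : ℝ)..1, f x = c * ∫ x in (-1 : ℝ)..1, jacobiWeight a b x * p x := by
  have h0 := integral_jacobiWeight_mul_pearson ha hb Q
  have hi := (intervalIntegrable_jacobiWeight_mul ha hb hp).const_mul c
  have hj := (intervalIntegrable_jacobiWeight_mul ha hb (f := fun x =>
    (1 - x ^ 2) * Q.derivative.eval x + (b - a - (a + b + 2) * x) * Q.eval x)
      (by fun_prop)).const_mul d
  have hs := intervalIntegral.integral_add hi hj
  rw [intervalIntegral.integral_const_mul, intervalIntegral.integral_const_mul, h0, mul_zero,
    add_zero] at hs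
  rw [← hs]
  refine intervalIntegral.integral_congr fun x hx => ?_
  rw [uIcc_of_le (by norm_num)] at hx
  simp only [h x hx]
  ring

lemma integral_jacobiWeight {a b : ℝ} (ha : -1 < a) (hb : -1 < b) :
    ∫ x in (-1 : ℝ)..1, jacobiWeight a b x =
      2 ^ (a + b + 1) * (Real.Gamma (a + 1) * Real.Gamma (b + 1) / Real.Gamma (a + b + 2)) := by
  have hB : Real.Gamma (a + 1) * Real.Gamma (b + 1) / Real.Gamma (a + b + 2) =
      ∫ t in (0 : ℝ)..1, (1 - t) ^ a * t ^ b := by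
    have h1 := Complex.betaIntegral_eq_Gamma_mul_div ((b + 1 : ℝ) : ℂ) ((a + 1 : ℝ) : ℂ)
      (by simp; linarith) (by simp; linarith)
    rw [← Complex.ofReal_add, Complex.Gamma_ofReal, Complex.Gamma_ofReal, Complex.Gamma_ofReal,
      ← Complex.ofReal_mul, ← Complex.ofReal_div, Complex.betaIntegral] at h1
    rw [← Complex.ofReal_inj]
    trans (((Real.Gamma (b + 1) * Real.Gamma (a + 1) / Real.Gamma (b + 1 + (a + 1)) : ℝ)) : ℂ)
    · congr 2
      · ring
      · congr 1; ring
    rw [← h1, ← intervalIntegral.integral_ofReal]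
    refine intervalIntegral.integral_congr fun t ht => ?_
    rw [uIcc_of_le zero_le_one] at ht
    have e1 : ((b + 1 : ℝ) : ℂ) - 1 = (b : ℂ) := by push_cast; ring
    have e2 : ((a + 1 : ℝ) : ℂ) - 1 = (a : ℂ) := by push_cast; ring
    have e3 : (1 : ℂ) - t = ((1 - t : ℝ) : ℂ) := by push_cast; ring
    simp only [e1, e2, e3]
    rw [← Complex.ofReal_cpow ht.1, ← Complex.ofReal_cpow (by linarith [ht.2])]
    push_cast; ring
  have hs := intervalIntegral.integral_comp_mul_add (a := (0 : ℝ)) (b := 1) (jacobiWeight a b)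
    two_ne_zero (-1)
  rw [show (2 : ℝ) * 0 + -1 = -1 by norm_num, show (2 : ℝ) * 1 + -1 = 1 by norm_num,
    smul_eq_mul] at hs
  have h2 : ∫ x in (-1 : ℝ)..1, jacobiWeight a b x =
      2 * ∫ x in (0 : ℝ)..1, jacobiWeight a b (2 * x + -1) := by
    rw [hs]; ring
  rw [h2, hB, ← intervalIntegral.integral_const_mul, ← intervalIntegral.integral_const_mul]
  refine intervalIntegral.integral_congr fun t ht => ?_
  rw [uIcc_of_le zero_le_one] at ht
  have e1 : 1 - (2 * t + -1) = 2 * (1 - t) := by ring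
  have e2 : 1 + (2 * t + -1) = 2 * t := by ring
  simp only [jacobiWeight]
  rw [e1, e2, Real.mul_rpow zero_le_two (by linarith [ht.2]), Real.mul_rpow zero_le_two ht.1,
    Real.rpow_add_one two_ne_zero, Real.rpow_add two_pos]
  ring

/-- `P` is the monic Jacobi polynomial of degree `n` with parameters `a`, `b`: the monic
polynomial solution of degree `n` of the Jacobi differential equation. -/
structure IsMonicJacobi (a b : ℝ) (n : ℕ) (P : ℝ[X]) : Prop where
  monic : P.Monic
  natDegree_eq : P.natDegree = n
  ode : (1 - X ^ 2) * derivative (derivative P) + (C (b - a) - C (a + b + 2) * X) * derivative P +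
    C (n * (n + a + b + 1)) * P = 0

lemma exists_derivative_eq (Q : ℝ[X]) : ∃ R : ℝ[X], derivative R = Q := by
  induction Q using Polynomial.induction_on' with
  | add p q hp hq =>
    obtain ⟨r, rfl⟩ := hp
    obtain ⟨s, rfl⟩ := hq
    exact ⟨r + s, derivative_add⟩
  | monomial n c =>
    refine ⟨monomial (n + 1) (c / (n + 1)), ?_⟩
    rw [derivative_monomial]
    have : (n : ℝ) + 1 ≠ 0 := by positivity
    simp [this]

lemma monic_of_derivative_eq {P Q : ℝ[X]} {n : ℕ} (hQ : Q.Monic) (hn : Q.natDegree = n)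
    (h : derivative P = C ((n : ℝ) + 1) * Q) : P.Monic ∧ P.natDegree = n + 1 := by
  have hn0 : (n : ℝ) + 1 ≠ 0 := by positivity
  have hc (k : ℕ) : P.coeff (k + 1) * ((k : ℝ) + 1) = ((n : ℝ) + 1) * Q.coeff k := by
    rw [← coeff_derivative, h, coeff_C_mul]
  have h1 : P.coeff (n + 1) = 1 := by
    have := hc n
    rw [← hn, hQ.coeff_natDegree, hn] at this
    exact mul_right_cancel₀ hn0 (by linarith)
  have h2 : P.natDegree ≤ n + 1 := by
    rw [natDegree_le_iff_coeff_eq_zero]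
    intro N hN
    obtain ⟨k, rfl⟩ : ∃ k, N = k + 1 := ⟨N - 1, by omega⟩
    have := hc k
    rw [coeff_eq_zero_of_natDegree_lt (by omega : Q.natDegree < k), mul_zero] at this
    exact (mul_eq_zero.mp this).resolve_right (by positivity)
  have h3 : P.natDegree = n + 1 :=
    le_antisymm h2 (le_natDegree_of_ne_zero (by rw [h1]; exact one_ne_zero))
  exact ⟨by rw [Monic, leadingCoeff, h3, h1], h3⟩

lemma exists_isMonicJacobi (n : ℕ) : ∀ a b : ℝ, -1 < a → -1 < b →
    ∃ P, IsMonicJacobi a b n P := by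
  induction n with
  | zero => exact fun a b _ _ => ⟨1, monic_one, natDegree_one, by simp⟩
  | succ n ih =>
    intro a b ha hb
    obtain ⟨Q, hQ⟩ := ih (a + 1) (b + 1) (by linarith) (by linarith)
    obtain ⟨R, hR⟩ := exists_derivative_eq (C ((n : ℝ) + 1) * Q)
    set l : ℝ := ((n + 1 : ℕ) : ℝ) * ((n + 1 : ℕ) + a + b + 1) with hl
    have hl0 : l ≠ 0 := by
      rw [hl]; push_cast
      have : 0 < (n : ℝ) + 1 + a + b + 1 := by
        have := n.cast_nonneg (α := ℝ)
        linarith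
      positivity
    set T : ℝ[X] := (1 - X ^ 2) * derivative (derivative R) +
      (C (b - a) - C (a + b + 2) * X) * derivative R + C l * R with hT
    have hdT : derivative T = 0 := by
      have hode := hQ.ode
      simp only [hT, hR, derivative_add, derivative_mul, derivative_sub, derivative_C,
        derivative_X, derivative_one, derivative_X_pow, derivative_zero, hl]
      simp only [map_add, map_sub, map_mul, map_ofNat, map_one, map_natCast, Nat.cast_add,
        Nat.cast_one, Nat.cast_ofNat] at hode ⊢
      linear_combination ((n : ℝ[X]) + 1) * hode
    obtain ⟨t, ht⟩ : ∃ t, T = C t := ⟨_, eq_C_of_natDegree_eq_zero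
      (derivative_eq_zero.mp hdT)⟩
    have hP : derivative (R - C (t / l)) = C ((n : ℝ) + 1) * Q := by simp [hR]
    obtain ⟨h1, h2⟩ := monic_of_derivative_eq hQ.monic hQ.natDegree_eq hP
    refine ⟨R - C (t / l), h1, h2, ?_⟩
    have h3 : C l * C (t / l) = C t := by rw [← C_mul, mul_div_cancel₀ _ hl0]
    rw [derivative_sub, derivative_C, sub_zero, ← hl]
    linear_combination ht - h3 - hT

lemma IsMonicJacobi.eval_ode {a b : ℝ} {n : ℕ} {P : ℝ[X]} (hP : IsMonicJacobi a b n P) (x : ℝ) :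
    (1 - x ^ 2) * (derivative (derivative P)).eval x +
      (b - a - (a + b + 2) * x) * (derivative P).eval x + n * (n + a + b + 1) * P.eval x = 0 := by
  have := congrArg (eval x) hP.ode
  simpa using this

lemma IsMonicJacobi.derivative {a b : ℝ} {n : ℕ} {P : ℝ[X]} (hP : IsMonicJacobi a b (n + 1) P) :
    IsMonicJacobi (a + 1) (b + 1) n (C ((n : ℝ) + 1)⁻¹ * derivative P) := by
  have hn0 : (n : ℝ) + 1 ≠ 0 := by positivity
  have hcoef : (C ((n : ℝ) + 1)⁻¹ * Polynomial.derivative P).coeff n = 1 := by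
    rw [coeff_C_mul, coeff_derivative, ← hP.natDegree_eq, hP.monic.coeff_natDegree]
    field_simp
  have hdeg : (C ((n : ℝ) + 1)⁻¹ * Polynomial.derivative P).natDegree = n := by
    refine le_antisymm ?_ (le_natDegree_of_ne_zero (by rw [hcoef]; exact one_ne_zero))
    refine (natDegree_C_mul_le _ _).trans ((natDegree_derivative_le P).trans ?_)
    rw [hP.natDegree_eq, Nat.add_sub_cancel]
  refine ⟨by rw [Monic, leadingCoeff, hdeg, hcoef], hdeg, ?_⟩
  have hode := congrArg Polynomial.derivative hP.ode
  simp only [derivative_add, derivative_mul, derivative_sub, derivative_C,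
    derivative_X, derivative_one, derivative_X_pow, derivative_zero] at hode ⊢
  simp only [map_add, map_sub, map_mul, map_ofNat, map_one, map_natCast, Nat.cast_add,
    Nat.cast_one, Nat.cast_ofNat] at hode ⊢
  linear_combination (C ((n : ℝ) + 1)⁻¹) * hode

/-- The squared `L²` norm of the monic Jacobi polynomial. -/
lemma IsMonicJacobi.integral_sq {n : ℕ} : ∀ {a b : ℝ} {P : ℝ[X]}, IsMonicJacobi a b n P →
    -1 < a → -1 < b → 0 < n + a + b + 1 →
    ∫ x in (-1 : ℝ)..1, jacobiWeight a b x * P.eval x ^ 2 =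
      2 ^ (2 * n + a + b + 1) * (Real.Gamma (n + 1) * Real.Gamma (n + a + b + 1) *
        Real.Gamma (n + a + 1) * Real.Gamma (n + b + 1)) /
        (Real.Gamma (2 * n + a + b + 1) * Real.Gamma (2 * n + a + b + 2)) := by
  induction n with
  | zero =>
    intro a b P hP ha hb hab
    rw [hP.monic.natDegree_eq_zero.mp hP.natDegree_eq]
    simp only [Nat.cast_zero, zero_add, mul_zero] at hab ⊢
    have := (Real.Gamma_pos_of_pos hab).ne'
    simp only [eval_one, one_pow, mul_one, integral_jacobiWeight ha hb, Real.Gamma_one]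
    field_simp
  | succ n ih =>
    intro a b P hP ha hb hab
    have hn := n.cast_nonneg (α := ℝ)
    have hn0 : (n : ℝ) + 1 ≠ 0 := by positivity
    have h1 := ih hP.derivative (by linarith) (by linarith) (by linarith)
    have h2 : ∫ x in (-1 : ℝ)..1, jacobiWeight (a + 1) (b + 1) x *
        (C ((n : ℝ) + 1)⁻¹ * Polynomial.derivative P).eval x ^ 2 =
        (n + a + b + 2) / (n + 1) *
          ∫ x in (-1 : ℝ)..1, jacobiWeight a b x * P.eval x ^ 2 := by
      refine integral_eq_mul_of_pearson ha hb (P * Polynomial.derivative P)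
        (d := ((n : ℝ) + 1)⁻¹ ^ 2) (by fun_prop) fun x hx => ?_
      have hode := hP.eval_ode x
      rw [jacobiWeight_add_one ha hb hx]
      simp only [derivative_mul, eval_mul, eval_add, eval_C]
      push_cast at hode
      field_simp
      linear_combination -(jacobiWeight a b x * eval x P) * hode
    rw [h2] at h1
    have hp : 0 < (n : ℝ) + a + b + 2 := by push_cast at hab; linarith
    have g1 : Real.Gamma (n + (a + 1) + (b + 1) + 1) =
        (n + a + b + 2) * Real.Gamma ((n + 1 : ℕ) + a + b + 1) := by
      rw [show (n : ℝ) + (a + 1) + (b + 1) + 1 = (n + a + b + 2) + 1 by ring,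
        Real.Gamma_add_one hp.ne']
      push_cast; congr 2; ring
    have g2 : Real.Gamma ((n + 1 : ℕ) + 1) = (n + 1) * Real.Gamma (n + 1) := by
      push_cast; rw [Real.Gamma_add_one hn0]
    rw [g1] at h1
    rw [g2]
    rw [div_mul_eq_mul_div, div_eq_iff hn0] at h1
    refine mul_left_cancel₀ hp.ne' (h1.trans ?_)
    push_cast
    rw [show 2 * (n : ℝ) + (a + 1) + (b + 1) + 1 = 2 * (n + 1) + a + b + 1 by ring,
      show 2 * (n : ℝ) + (a + 1) + (b + 1) + 2 = 2 * (n + 1) + a + b + 2 by ring,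
      show (n : ℝ) + (a + 1) + 1 = n + 1 + a + 1 by ring,
      show (n : ℝ) + (b + 1) + 1 = n + 1 + b + 1 by ring]
    ring

lemma log_Gamma_add_add_log_Gamma_sub_le {y s : ℝ} (hy : 1 / 2 < y) (hs : |s| ≤ 1 / 2) :
    Real.log (Real.Gamma (y + s)) + Real.log (Real.Gamma (y - s)) ≤
      (1 - 2 * |s|) * (2 * Real.log (Real.Gamma y)) +
        2 * |s| * (Real.log (Real.Gamma (y + 1 / 2)) + Real.log (Real.Gamma (y - 1 / 2))) := by
  have key (t : ℝ) (h0 : 0 ≤ t) (h1 : t ≤ 1 / 2) :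
      Real.log (Real.Gamma (y + t)) + Real.log (Real.Gamma (y - t)) ≤
      (1 - 2 * t) * (2 * Real.log (Real.Gamma y)) +
        2 * t * (Real.log (Real.Gamma (y + 1 / 2)) + Real.log (Real.Gamma (y - 1 / 2))) := by
    have hy0 : y ∈ Ioi (0 : ℝ) := by simp only [mem_Ioi]; linarith
    have hy1 : y + 1 / 2 ∈ Ioi (0 : ℝ) := by simp only [mem_Ioi]; linarith
    have hy2 : y - 1 / 2 ∈ Ioi (0 : ℝ) := by simp only [mem_Ioi]; linarith
    have c1 := Real.convexOn_log_Gamma.2 hy0 hy1 (by linarith : 0 ≤ 1 - 2 * t)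
      (by linarith : 0 ≤ 2 * t) (by ring)
    have c2 := Real.convexOn_log_Gamma.2 hy0 hy2 (by linarith : 0 ≤ 1 - 2 * t)
      (by linarith : 0 ≤ 2 * t) (by ring)
    simp only [smul_eq_mul, Function.comp_apply] at c1 c2
    rw [show (1 - 2 * t) * y + 2 * t * (y + 1 / 2) = y + t by ring] at c1
    rw [show (1 - 2 * t) * y + 2 * t * (y - 1 / 2) = y - t by ring] at c2
    linarith
  rcases le_total 0 s with h | h
  · rw [abs_of_nonneg h] at hs ⊢
    exact key s h hs
  · rw [abs_of_nonpos h] at hs ⊢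
    have := key (-s) (by linarith) hs
    rw [sub_neg_eq_add, ← sub_eq_add_neg] at this
    linarith

/-- The quotient of Gamma values governing the `L²` norms of Jacobi polynomials. -/
noncomputable def gammaQuotient (s d y : ℝ) : ℝ :=
  Real.Gamma (y + s) * Real.Gamma (y - s) * Real.Gamma (y + d) * Real.Gamma (y - d) /
    (Real.Gamma (y - 1 / 2) * Real.Gamma (y + 1 / 2) * Real.Gamma y ^ 2)

lemma gammaQuotient_pos {s d y : ℝ} (hy : 1 / 2 < y) (hsd : |s| + |d| ≤ 1 / 2) :
    0 < gammaQuotient s d y := by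
  have hs := abs_le.mp (by linarith [abs_nonneg d] : |s| ≤ 1 / 2)
  have hd := abs_le.mp (by linarith [abs_nonneg s] : |d| ≤ 1 / 2)
  have p (t : ℝ) (ht : 0 < t) := Real.Gamma_pos_of_pos ht
  have h1 := p (y + s) (by linarith)
  have h2 := p (y - s) (by linarith)
  have h3 := p (y + d) (by linarith)
  have h4 := p (y - d) (by linarith)
  have h5 := p (y - 1 / 2) (by linarith)
  have h6 := p (y + 1 / 2) (by linarith)
  have h7 := p y (by linarith)
  unfold gammaQuotient
  positivity

lemma gammaQuotient_le_one {s d y : ℝ} (hy : 1 / 2 < y) (hsd : |s| + |d| ≤ 1 / 2) :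
    gammaQuotient s d y ≤ 1 := by
  have hs' : |s| ≤ 1 / 2 := by linarith [abs_nonneg d]
  have hd' : |d| ≤ 1 / 2 := by linarith [abs_nonneg s]
  have hs := abs_le.mp hs'
  have hd := abs_le.mp hd'
  have p (t : ℝ) (ht : 0 < t) := Real.Gamma_pos_of_pos ht
  have h1 := p (y + s) (by linarith)
  have h2 := p (y - s) (by linarith)
  have h3 := p (y + d) (by linarith)
  have h4 := p (y - d) (by linarith)
  have h5 := p (y - 1 / 2) (by linarith)
  have h6 := p (y + 1 / 2) (by linarith)
  have h7 := p y (by linarith)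
  have e1 := log_Gamma_add_add_log_Gamma_sub_le hy hs'
  have e2 := log_Gamma_add_add_log_Gamma_sub_le hy hd'
  have e3 : 2 * Real.log (Real.Gamma y) ≤
      Real.log (Real.Gamma (y + 1 / 2)) + Real.log (Real.Gamma (y - 1 / 2)) := by
    have c := Real.convexOn_log_Gamma.2 (x := y + 1 / 2) (y := y - 1 / 2)
      (by simp only [mem_Ioi]; linarith) (by simp only [mem_Ioi]; linarith)
      (by norm_num : (0 : ℝ) ≤ 1 / 2) (by norm_num : (0 : ℝ) ≤ 1 / 2) (by norm_num)
    simp only [smul_eq_mul, Function.comp_apply] at c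
    rw [show 1 / 2 * (y + 1 / 2) + 1 / 2 * (y - 1 / 2) = y by ring] at c
    linarith
  rw [gammaQuotient, div_le_one (by positivity), ← Real.log_le_log_iff (by positivity)
    (by positivity), Real.log_mul (by positivity) (by positivity),
    Real.log_mul (by positivity) (by positivity), Real.log_mul (by positivity) (by positivity),
    Real.log_mul (by positivity) (by positivity), Real.log_mul (by positivity) (by positivity),
    Real.log_pow]
  push_cast
  nlinarith [mul_nonneg (by linarith : 0 ≤ 1 / 2 - (|s| + |d|)) (sub_nonneg.mpr e3)]

lemma gammaQuotient_add_one {s d y : ℝ} (hy : 1 / 2 < y) (hsd : |s| + |d| ≤ 1 / 2) :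
    gammaQuotient s d (y + 1) = gammaQuotient s d y *
      ((y ^ 2 - s ^ 2) * (y ^ 2 - d ^ 2) / ((y ^ 2 - 1 / 4) * y ^ 2)) := by
  have hs := abs_le.mp (by linarith [abs_nonneg d] : |s| ≤ 1 / 2)
  have hd := abs_le.mp (by linarith [abs_nonneg s] : |d| ≤ 1 / 2)
  have g (t : ℝ) (ht : 0 < y + t) :
      Real.Gamma (y + 1 + t) = (y + t) * Real.Gamma (y + t) := by
    rw [← Real.Gamma_add_one ht.ne']; congr 1; ring
  have p (t : ℝ) (ht : 0 < t) := (Real.Gamma_pos_of_pos ht).ne'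
  have h5 := p (y - 1 / 2) (by linarith)
  have h6 := p (y + 1 / 2) (by linarith)
  have h7 := p y (by linarith)
  have g0 := g 0 (by linarith)
  simp only [add_zero] at g0
  have q1 : y - 1 / 2 ≠ 0 := by linarith
  have q2 : y + 1 / 2 ≠ 0 := by linarith
  have q3 : y ≠ 0 := by linarith
  have q4 : y ^ 2 - 1 / 4 = (y - 1 / 2) * (y + 1 / 2) := by ring
  simp only [sub_eq_add_neg] at h5 q1 q4 ⊢
  simp only [gammaQuotient, sub_eq_add_neg]
  rw [g s (by linarith), g (-s) (by linarith), g d (by linarith), g (-d) (by linarith),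
    g (-(1 / 2)) (by linarith), g (1 / 2) (by linarith), g0, q4, div_mul_div_comm,
    div_eq_div_iff (by positivity) (by positivity)]
  ring

lemma gammaQuotient_mul_le_one {s d y : ℝ} (hy : 1 / 2 < y) (hsd : |s| + |d| ≤ 1 / 2) :
    gammaQuotient s d y * (1 + (1 / 2 - 2 * (s ^ 2 + d ^ 2)) / (2 * (y - 1 / 2))) ≤ 1 := by
  set c : ℝ := 1 / 2 - 2 * (s ^ 2 + d ^ 2) with hc
  have hc0 : 0 ≤ c := by
    have h1 : s ^ 2 + d ^ 2 ≤ (|s| + |d|) ^ 2 := by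
      rw [← sq_abs s, ← sq_abs d]
      nlinarith [mul_nonneg (abs_nonneg s) (abs_nonneg d)]
    have h2 : (|s| + |d|) ^ 2 ≤ (1 / 2) ^ 2 := by gcongr
    rw [hc]; linarith
  have step (z : ℝ) (hz : 1 / 2 < z) :
      gammaQuotient s d z * (1 + c / (2 * (z - 1 / 2))) ≤
        gammaQuotient s d (z + 1) * (1 + c / (2 * (z + 1 - 1 / 2))) := by
    rw [gammaQuotient_add_one hz hsd, mul_assoc]
    refine mul_le_mul_of_nonneg_left ?_ (gammaQuotient_pos hz hsd).le
    obtain ⟨N, rfl⟩ : ∃ N, z = N + 1 / 2 := ⟨z - 1 / 2, by ring⟩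
    have hN : 0 < N := by linarith
    have e1 : (N + 1 / 2) ^ 2 - 1 / 4 = N * (N + 1) := by ring
    have h1 : (N * (N + 1) + c / 2) / (N * (N + 1)) ≤
        ((N + 1 / 2) ^ 2 - s ^ 2) * ((N + 1 / 2) ^ 2 - d ^ 2) /
          (((N + 1 / 2) ^ 2 - 1 / 4) * (N + 1 / 2) ^ 2) := by
      rw [e1, div_le_div_iff₀ (by positivity) (by positivity)]
      have : 0 ≤ N * (N + 1) * (s ^ 2 * d ^ 2) := by positivity
      rw [hc]
      nlinarith
    refine le_trans ?_ (mul_le_mul_of_nonneg_right h1 ?_)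
    · rw [show N + 1 / 2 - 1 / 2 = N by ring, show N + 1 / 2 + 1 - 1 / 2 = N + 1 by ring]
      rw [div_mul_eq_mul_div, le_div_iff₀ (by positivity)]
      have e2 : (1 + c / (2 * N)) * (N * (N + 1)) = N * (N + 1) + c / 2 * (N + 1) := by
        field_simp
      have e3 : (N * (N + 1) + c / 2) * (1 + c / (2 * (N + 1))) =
          N * (N + 1) + c / 2 * (N + 1) + c ^ 2 / (4 * (N + 1)) := by
        field_simp; ring
      rw [e2, e3]
      have : 0 ≤ c ^ 2 / (4 * (N + 1)) := by positivity
      linarith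
    · have : 0 < N + 1 / 2 + 1 - 1 / 2 := by linarith
      positivity
  have iter (k : ℕ) : gammaQuotient s d y * (1 + c / (2 * (y - 1 / 2))) ≤
      gammaQuotient s d (y + k) * (1 + c / (2 * (y + k - 1 / 2))) := by
    induction k with
    | zero => simp
    | succ k ih =>
      refine ih.trans ?_
      have := step (y + k) (by have := k.cast_nonneg (α := ℝ); linarith)
      push_cast
      rwa [← add_assoc]
  have bound (k : ℕ) : gammaQuotient s d y * (1 + c / (2 * (y - 1 / 2))) ≤
      1 + c / (2 * (y + k - 1 / 2)) := by
    have hk := k.cast_nonneg (α := ℝ)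
    refine (iter k).trans ?_
    have : 0 < y + k - 1 / 2 := by linarith
    exact mul_le_of_le_one_left (by positivity) (gammaQuotient_le_one (by linarith) hsd)
  have ht : Filter.Tendsto (fun k : ℕ => 2 * (y + k - 1 / 2)) Filter.atTop Filter.atTop := by
    refine Filter.Tendsto.const_mul_atTop two_pos ?_
    have := Filter.tendsto_atTop_add_const_left Filter.atTop (y - 1 / 2)
      (tendsto_natCast_atTop_atTop (R := ℝ))
    exact this.congr fun k => by ring
  have lim := (ht.const_div_atTop c).const_add 1
  rw [add_zero] at lim
  exact ge_of_tendsto' lim bound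

lemma IsMonicJacobi.integral_sq_mul_le {n : ℕ} {a b : ℝ} {P : ℝ[X]} (hP : IsMonicJacobi a b n P)
    (hn : 1 ≤ n) (ha : |a| ≤ 1 / 2) (hb : |b| ≤ 1 / 2) :
    (∫ x in (-1 : ℝ)..1, jacobiWeight a b x * P.eval x ^ 2) *
      (1 + (1 / 2 - (a ^ 2 + b ^ 2)) / (2 * n + a + b + 1)) ≤
        Real.pi * 2 ^ (-(2 * n + a + b)) := by
  have hn' : (1 : ℝ) ≤ n := by exact_mod_cast hn
  have ha' := abs_le.mp ha
  have hb' := abs_le.mp hb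
  have hsd : |(a + b) / 2| + |(a - b) / 2| ≤ 1 / 2 := by
    rcases abs_cases ((a + b) / 2) with h | h <;> rcases abs_cases ((a - b) / 2) with h' | h' <;>
      linarith
  set N : ℝ := n + (a + b + 1) / 2 with hN
  have hN0 : 0 < N := by linarith
  have key := gammaQuotient_mul_le_one (y := N + 1 / 2) (by linarith) hsd
  have d1 := Real.Gamma_mul_Gamma_add_half N
  have d2 := Real.Gamma_mul_Gamma_add_half (N + 1 / 2)
  have p1 := Real.Gamma_pos_of_pos hN0
  have p2 := Real.Gamma_pos_of_pos (by linarith : 0 < N + 1 / 2)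
  have p3 := Real.Gamma_pos_of_pos (by linarith : 0 < N + 1)
  have p4 := Real.Gamma_pos_of_pos (by linarith : 0 < 2 * N)
  have p5 := Real.Gamma_pos_of_pos (by linarith : 0 < 2 * (N + 1 / 2))
  have hI : ∫ x in (-1 : ℝ)..1, jacobiWeight a b x * P.eval x ^ 2 =
      gammaQuotient ((a + b) / 2) ((a - b) / 2) (N + 1 / 2) *
        (Real.pi * 2 ^ (-(2 * n + a + b))) := by
    rw [hP.integral_sq (by linarith) (by linarith) (by linarith), gammaQuotient]
    rw [show N + 1 / 2 + (a + b) / 2 = n + a + b + 1 by rw [hN]; ring,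
      show N + 1 / 2 - (a + b) / 2 = n + 1 by rw [hN]; ring,
      show N + 1 / 2 + (a - b) / 2 = n + a + 1 by rw [hN]; ring,
      show N + 1 / 2 - (a - b) / 2 = n + b + 1 by rw [hN]; ring,
      show N + 1 / 2 - 1 / 2 = N by ring, show N + 1 / 2 + 1 / 2 = N + 1 by ring,
      show 2 * (n : ℝ) + a + b + 1 = 2 * N by rw [hN]; ring,
      show 2 * (n : ℝ) + a + b + 2 = 2 * (N + 1 / 2) by rw [hN]; ring,
      show -(2 * (n : ℝ) + a + b) = 1 - 2 * N by rw [hN]; ring]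
    rw [show N + 1 / 2 + 1 / 2 = N + 1 by ring] at d2
    have hpi : √Real.pi * √Real.pi = Real.pi := Real.mul_self_sqrt Real.pi_pos.le
    have h2 : (2 : ℝ) ^ (2 * N) * 2 ^ (1 - 2 * (N + 1 / 2)) = 1 := by
      rw [← Real.rpow_add two_pos]; ring_nf; exact Real.rpow_zero _
    rw [div_mul_eq_mul_div, div_eq_div_iff (by positivity) (by positivity)]
    have d3 : Real.Gamma N * Real.Gamma (N + 1) * Real.Gamma (N + 1 / 2) ^ 2 * 2 ^ (2 * N) =
        Real.Gamma (2 * N) * Real.Gamma (2 * (N + 1 / 2)) * 2 ^ (1 - 2 * N) * Real.pi := by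
      calc _ = (Real.Gamma N * Real.Gamma (N + 1 / 2)) *
            (Real.Gamma (N + 1 / 2) * Real.Gamma (N + 1)) * 2 ^ (2 * N) := by ring
        _ = _ := by
          rw [d1, d2]
          linear_combination (Real.Gamma (2 * N) * Real.Gamma (2 * (N + 1 / 2)) *
            2 ^ (1 - 2 * N)) * (√Real.pi * √Real.pi * h2 + hpi)
    linear_combination (Real.Gamma (n + 1) * Real.Gamma (n + a + b + 1) *
      Real.Gamma (n + a + 1) * Real.Gamma (n + b + 1)) * d3
  rw [hI]
  have e : (1 / 2 - 2 * (((a + b) / 2) ^ 2 + ((a - b) / 2) ^ 2)) / (2 * (N + 1 / 2 - 1 / 2)) =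
      (1 / 2 - (a ^ 2 + b ^ 2)) / (2 * n + a + b + 1) := by
    rw [hN]; congr 1 <;> ring
  rw [e] at key
  have hpos : 0 < Real.pi * (2 : ℝ) ^ (-(2 * n + a + b)) := by positivity
  nlinarith

/-- Sonin-type comparison of the energy `E` with the amplitude `V`. -/
lemma mul_le_energy {l r m : ℝ} {E φ φ' V : ℝ → ℝ}
    (hφ : ∀ x ∈ Icc l r, HasDerivAt φ (φ' x) x)
    (hE : ∀ x ∈ Icc l r, HasDerivAt E (φ' x * V x) x) (hm : 0 < m)
    (hmφ : ∀ x ∈ Icc l r, m ≤ φ x) (hV : ∀ x ∈ Icc l r, 0 ≤ V x)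
    (hVE : ∀ x ∈ Icc l r, φ x * V x ≤ E x)
    (hsign : ∃ t ∈ Icc l r, (∀ x ∈ Ioo l t, φ' x ≤ 0) ∧ ∀ x ∈ Ioo t r, 0 ≤ φ' x) :
    V l * m ≤ E r ∧ V r * m ≤ E l := by
  obtain ⟨t, ht, hneg, hpos⟩ := hsign
  have hl : Icc l t ⊆ Icc l r := Icc_subset_Icc_right ht.2
  have hr : Icc t r ⊆ Icc l r := Icc_subset_Icc_left ht.1
  have hφ0 : ∀ x ∈ Icc l r, 0 < φ x := fun x hx => hm.trans_le (hmφ x hx)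
  have hS : ∀ x ∈ Icc l r,
      HasDerivAt (fun x => E x / φ x) (φ' x * (φ x * V x - E x) / φ x ^ 2) x := fun x hx =>
    ((hE x hx).div (hφ x hx) (hφ0 x hx).ne').congr_deriv (by ring)
  have cE : ContinuousOn E (Icc l r) := fun x hx => (hE x hx).continuousAt.continuousWithinAt
  have cS : ContinuousOn (fun x => E x / φ x) (Icc l r) :=
    fun x hx => (hS x hx).continuousAt.continuousWithinAt
  have E1 : AntitoneOn E (Icc l t) := antitoneOn_of_hasDerivWithinAt_nonpos (convex_Icc l t)
    (cE.mono hl) (fun x hx => (hE x (hl (interior_subset hx))).hasDerivWithinAt)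
    fun x hx => mul_nonpos_of_nonpos_of_nonneg (hneg x (interior_Icc.subset hx))
      (hV x (hl (interior_subset hx)))
  have E2 : MonotoneOn E (Icc t r) := monotoneOn_of_hasDerivWithinAt_nonneg (convex_Icc t r)
    (cE.mono hr) (fun x hx => (hE x (hr (interior_subset hx))).hasDerivWithinAt)
    fun x hx => mul_nonneg (hpos x (interior_Icc.subset hx)) (hV x (hr (interior_subset hx)))
  have S1 : MonotoneOn (fun x => E x / φ x) (Icc l t) :=
    monotoneOn_of_hasDerivWithinAt_nonneg (convex_Icc l t)
    (cS.mono hl) (fun x hx => (hS x (hl (interior_subset hx))).hasDerivWithinAt)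
    fun x hx => div_nonneg (mul_nonneg_of_nonpos_of_nonpos (hneg x (interior_Icc.subset hx))
      (sub_nonpos.mpr (hVE x (hl (interior_subset hx))))) (sq_nonneg _)
  have S2 : AntitoneOn (fun x => E x / φ x) (Icc t r) :=
    antitoneOn_of_hasDerivWithinAt_nonpos (convex_Icc t r)
    (cS.mono hr) (fun x hx => (hS x (hr (interior_subset hx))).hasDerivWithinAt)
    fun x hx => div_nonpos_of_nonpos_of_nonneg (mul_nonpos_of_nonneg_of_nonpos
      (hpos x (interior_Icc.subset hx)) (sub_nonpos.mpr (hVE x (hr (interior_subset hx)))))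
      (sq_nonneg _)
  have main (x : ℝ) (hx : x ∈ Icc l r) (h : E x / φ x ≤ E t / φ t) : V x * m ≤ E t := by
    have h1 : V x ≤ E x / φ x := by
      rw [le_div_iff₀ (hφ0 x hx), mul_comm]; exact hVE x hx
    calc V x * m ≤ V x * φ t := mul_le_mul_of_nonneg_left (hmφ t ht) (hV x hx)
      _ ≤ E t / φ t * φ t := mul_le_mul_of_nonneg_right (h1.trans h) (hφ0 t ht).le
      _ = E t := div_mul_cancel₀ _ (hφ0 t ht).ne'
  have ll : l ∈ Icc l t := left_mem_Icc.mpr ht.1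
  have tl : t ∈ Icc l t := right_mem_Icc.mpr ht.1
  have tr : t ∈ Icc t r := left_mem_Icc.mpr ht.2
  have rr : r ∈ Icc t r := right_mem_Icc.mpr ht.2
  exact ⟨(main l (hl ll) (S1 ll tl ht.1)).trans (E2 tr rr ht.2),
    (main r (hr rr) (S2 tr rr ht.2)).trans (E1 ll tl ht.1)⟩

lemma exists_sign_change {A B l r : ℝ} (hA : 0 ≤ A) (hB : 0 ≤ B) (hl : -1 < l) (hlr : l ≤ r)
    (hr : r < 1) : ∃ t ∈ Icc l r,
      (∀ x ∈ Ioo l t, A / (2 * (1 - x) ^ 2) - B / (2 * (1 + x) ^ 2) ≤ 0) ∧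
        ∀ x ∈ Ioo t r, 0 ≤ A / (2 * (1 - x) ^ 2) - B / (2 * (1 + x) ^ 2) := by
  set g : ℝ → ℝ := fun x => A / (2 * (1 - x) ^ 2) - B / (2 * (1 + x) ^ 2) with hg
  have hmono : MonotoneOn g (Icc l r) := by
    intro x hx y hy hxy
    have h1 : 0 < 1 - y := by linarith [hy.2]
    have h2 : 0 < 1 + x := by linarith [hx.1]
    simp only [hg]
    gcongr
  have hcont : ContinuousOn g (Icc l r) := by
    intro x hx
    have h1 : 1 - x ≠ 0 := by linarith [hx.2]
    have h2 : 1 + x ≠ 0 := by linarith [hx.1]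
    refine ContinuousAt.continuousWithinAt ?_
    simp only [hg]
    fun_prop (disch := positivity)
  have ll : l ∈ Icc l r := left_mem_Icc.mpr hlr
  have rr : r ∈ Icc l r := right_mem_Icc.mpr hlr
  rcases le_total 0 (g l) with h | h
  · exact ⟨l, ll, fun x hx => absurd hx (by simp), fun x hx =>
      h.trans (hmono ll (Ioo_subset_Icc_self hx) hx.1.le)⟩
  rcases le_total (g r) 0 with h' | h'
  · exact ⟨r, rr, fun x hx => (hmono (Ioo_subset_Icc_self hx) rr hx.2.le).trans h',
      fun x hx => absurd hx (by simp)⟩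
  obtain ⟨t, ht, h0⟩ := intermediate_value_Icc hlr hcont ⟨h, h'⟩
  exact ⟨t, ht, fun x hx => (hmono ⟨hx.1.le, hx.2.le.trans ht.2⟩ ht hx.2.le).trans h0.le,
    fun x hx => h0.ge.trans (hmono ht ⟨ht.1.trans hx.1.le, hx.2.le⟩ hx.1.le)⟩

lemma jacobiWeight_add_one_of_mem_Ioo (a b : ℝ) {x : ℝ} (hx : x ∈ Ioo (-1 : ℝ) 1) :
    jacobiWeight (a + 1) (b + 1) x = jacobiWeight a b x * (1 - x ^ 2) := by
  simp only [jacobiWeight]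
  rw [Real.rpow_add_one (by linarith [hx.2]), Real.rpow_add_one (by linarith [hx.1])]
  ring

lemma jacobiWeight_add_half (a b : ℝ) {x : ℝ} (hx : x ∈ Ioo (-1 : ℝ) 1) :
    jacobiWeight (a + 1 / 2) (b + 1 / 2) x = jacobiWeight a b x * √(1 - x ^ 2) := by
  have h1 : 0 < 1 - x := by linarith [hx.2]
  have h2 : 0 < 1 + x := by linarith [hx.1]
  simp only [jacobiWeight]
  rw [Real.rpow_add h1, Real.rpow_add h2, show 1 - x ^ 2 = (1 - x) * (1 + x) by ring,
    Real.sqrt_mul h1.le, Real.sqrt_eq_rpow, Real.sqrt_eq_rpow]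
  ring

lemma jacobiWeight_nonneg (a b : ℝ) {x : ℝ} (hx : x ∈ Icc (-1 : ℝ) 1) : 0 ≤ jacobiWeight a b x :=
  mul_nonneg (Real.rpow_nonneg (by linarith [hx.2]) _) (Real.rpow_nonneg (by linarith [hx.1]) _)

/-- Derivative of the Sonin energy of a monic Jacobi polynomial. -/
lemma IsMonicJacobi.hasDerivAt_energy {a b : ℝ} {n : ℕ} {P : ℝ[X]} (hP : IsMonicJacobi a b n P)
    {x : ℝ} (hx : x ∈ Ioo (-1 : ℝ) 1) {φ : ℝ → ℝ} {φ' : ℝ} (hφ : HasDerivAt φ φ' x)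
    (hφx : (1 - x ^ 2) * φ x = (n + (a + b + 1) / 2) ^ 2 * (1 - x ^ 2)
      + (1 / 4 - a ^ 2) * (1 + x) / 2 + (1 / 4 - b ^ 2) * (1 - x) / 2) :
    HasDerivAt (fun y => jacobiWeight (a + 1 / 2) (b + 1 / 2) y *
      (((1 - y ^ 2) * P.derivative.eval y +
        ((b + 1 / 2) * (1 - y) - (a + 1 / 2) * (1 + y)) / 2 * P.eval y) ^ 2 / (1 - y ^ 2)
        + φ y * P.eval y ^ 2))
      (φ' * (jacobiWeight (a + 1 / 2) (b + 1 / 2) x * P.eval x ^ 2)) x := by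
  have hx2 : 0 < 1 - x ^ 2 := by nlinarith [hx.1, hx.2]
  have hW := hasDerivAt_jacobiWeight (a - 1 / 2) (b - 1 / 2) hx
  have hW0 := jacobiWeight_add_one_of_mem_Ioo (a - 1 / 2) (b - 1 / 2) hx
  rw [show a - 1 / 2 + 1 = a + 1 / 2 by ring, show b - 1 / 2 + 1 = b + 1 / 2 by ring] at hW hW0
  have d1 : HasDerivAt (fun y : ℝ => 1 - y ^ 2) (-(2 * x)) x := by
    simpa using ((hasDerivAt_id x).pow 2).const_sub 1
  have d2 : HasDerivAt (fun y : ℝ => ((b + 1 / 2) * (1 - y) - (a + 1 / 2) * (1 + y)) / 2)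
      (-(a + b + 1) / 2) x := by
    refine (((((hasDerivAt_id x).const_sub 1).const_mul (b + 1 / 2)).sub
      (((hasDerivAt_id x).const_add 1).const_mul (a + 1 / 2))).div_const 2).congr_deriv ?_
    ring
  have dP := P.hasDerivAt x
  have dP' := P.derivative.hasDerivAt x
  have ode := hP.eval_ode x
  set Z : ℝ → ℝ := fun y => (1 - y ^ 2) * P.derivative.eval y +
        ((b + 1 / 2) * (1 - y) - (a + 1 / 2) * (1 + y)) / 2 * P.eval y with hZ
  obtain ⟨Z', dZ, hZ'⟩ : ∃ Z', HasDerivAt Z Z' x ∧ (1 - x ^ 2) * Z' +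
      (((b + 1 / 2) * (1 - x) - (a + 1 / 2) * (1 + x)) / 2 + x) * Z x
        + (1 - x ^ 2) * φ x * P.eval x = 0 := by
    refine ⟨_, (d1.mul dP').add (d2.mul dP), ?_⟩
    simp only [hZ]
    linear_combination P.eval x * hφx + (1 - x ^ 2) * ode
  refine (hW.mul (((dZ.pow 2).div d1 hx2.ne').add (hφ.mul (dP.pow 2)))).congr_deriv ?_
  simp only [Pi.mul_apply, Pi.add_apply, Pi.pow_apply, Pi.div_apply, Nat.cast_ofNat,
    Nat.add_one_sub_one, pow_one]
  have hZx : (1 - x ^ 2) * P.derivative.eval x = Z x -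
        ((b + 1 / 2) * (1 - x) - (a + 1 / 2) * (1 + x)) / 2 * P.eval x := by
    simp only [hZ]; ring
  rw [hW0]
  generalize jacobiWeight (a - 1 / 2) (b - 1 / 2) x = w
  generalize Z x = z at *
  generalize P.derivative.eval x = p1 at *
  generalize P.eval x = p0 at *
  field_simp
  linear_combination 2 * z * w * 2 * hZ' + 4 * w * (1 - x ^ 2) * p0 * φ x * hZx

lemma IsMonicJacobi.sq_mul_le_energy {a b : ℝ} {n : ℕ} {P : ℝ[X]} (hP : IsMonicJacobi a b n P)
    (ha : |a| ≤ 1 / 2) (hb : |b| ≤ 1 / 2) (hn : 1 ≤ n)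
    {x₀ x : ℝ} (hx₀ : x₀ ∈ Ioo (-1 : ℝ) 1) (hx : x ∈ Ioo (-1 : ℝ) 1) :
    jacobiWeight (a + 1 / 2) (b + 1 / 2) x₀ * P.eval x₀ ^ 2 *
      ((n + (a + b + 1) / 2) ^ 2 + (1 / 2 - (a ^ 2 + b ^ 2)) / 4) * √(1 - x ^ 2) ≤
    jacobiWeight a b x * (((1 - x ^ 2) * P.derivative.eval x +
        ((b + 1 / 2) * (1 - x) - (a + 1 / 2) * (1 + x)) / 2 * P.eval x) ^ 2 +
        ((n + (a + b + 1) / 2) ^ 2 * (1 - x ^ 2) + (1 / 4 - a ^ 2) * (1 + x) / 2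
          + (1 / 4 - b ^ 2) * (1 - x) / 2) * P.eval x ^ 2) := by
  have hA : 0 ≤ 1 / 4 - a ^ 2 := by nlinarith [abs_le.mp ha]
  have hB : 0 ≤ 1 / 4 - b ^ 2 := by nlinarith [abs_le.mp hb]
  have hN : 0 < (n : ℝ) + (a + b + 1) / 2 := by
    have : (1 : ℝ) ≤ n := by exact_mod_cast hn
    linarith [(abs_le.mp ha).1, (abs_le.mp hb).1]
  set A := 1 / 4 - a ^ 2 with hAdef
  set B := 1 / 4 - b ^ 2 with hBdef
  set N := (n : ℝ) + (a + b + 1) / 2 with hNdef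
  set φ : ℝ → ℝ := fun y => N ^ 2 + A / (2 * (1 - y)) + B / (2 * (1 + y)) with hφ
  set φ' : ℝ → ℝ := fun y => A / (2 * (1 - y) ^ 2) - B / (2 * (1 + y) ^ 2) with hφ'
  have dφ : ∀ y ∈ Ioo (-1 : ℝ) 1, HasDerivAt φ (φ' y) y := by
    intro y hy
    have h1 : 1 - y ≠ 0 := by linarith [hy.2]
    have h2 : 1 + y ≠ 0 := by linarith [hy.1]
    have e1 := ((hasDerivAt_const y A).div (((hasDerivAt_id y).const_sub 1).const_mul 2)
      (mul_ne_zero two_ne_zero h1))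
    have e2 := ((hasDerivAt_const y B).div (((hasDerivAt_id y).const_add 1).const_mul 2)
      (mul_ne_zero two_ne_zero h2))
    refine ((e1.const_add (N ^ 2)).add e2).congr_deriv ?_
    simp only [hφ', id]
    field_simp
    ring
  have hψ : ∀ y ∈ Ioo (-1 : ℝ) 1, (1 - y ^ 2) * φ y =
      N ^ 2 * (1 - y ^ 2) + A * (1 + y) / 2 + B * (1 - y) / 2 := by
    intro y hy
    have h1 : 1 - y ≠ 0 := by linarith [hy.2]
    have h2 : 1 + y ≠ 0 := by linarith [hy.1]
    simp only [hφ]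
    field_simp
    ring
  set V : ℝ → ℝ := fun y => jacobiWeight (a + 1 / 2) (b + 1 / 2) y * P.eval y ^ 2 with hV
  set Z : ℝ → ℝ := fun y => (1 - y ^ 2) * P.derivative.eval y +
        ((b + 1 / 2) * (1 - y) - (a + 1 / 2) * (1 + y)) / 2 * P.eval y with hZ
  set E : ℝ → ℝ := fun y => jacobiWeight (a + 1 / 2) (b + 1 / 2) y *
      (Z y ^ 2 / (1 - y ^ 2) + φ y * P.eval y ^ 2) with hE
  have dE : ∀ y ∈ Ioo (-1 : ℝ) 1, HasDerivAt E (φ' y * V y) y := fun y hy =>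
    hP.hasDerivAt_energy hy (dφ y hy) (hψ y hy)
  have hm : 0 < N ^ 2 + (1 / 2 - (a ^ 2 + b ^ 2)) / 4 := by nlinarith
  have hmφ : ∀ y ∈ Ioo (-1 : ℝ) 1, N ^ 2 + (1 / 2 - (a ^ 2 + b ^ 2)) / 4 ≤ φ y := by
    intro y hy
    have h1 : A / 4 ≤ A / (2 * (1 - y)) :=
      div_le_div_of_nonneg_left hA (by linarith [hy.2]) (by linarith [hy.1])
    have h2 : B / 4 ≤ B / (2 * (1 + y)) :=
      div_le_div_of_nonneg_left hB (by linarith [hy.1]) (by linarith [hy.2])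
    simp only [hφ]
    linarith
  have hV0 : ∀ y ∈ Ioo (-1 : ℝ) 1, 0 ≤ V y := fun y hy =>
    mul_nonneg (jacobiWeight_nonneg _ _ (Ioo_subset_Icc_self hy)) (sq_nonneg _)
  have hVE : ∀ y ∈ Ioo (-1 : ℝ) 1, φ y * V y ≤ E y := by
    intro y hy
    have h1 : 0 ≤ jacobiWeight (a + 1 / 2) (b + 1 / 2) y * (Z y ^ 2 / (1 - y ^ 2)) :=
      mul_nonneg (jacobiWeight_nonneg _ _ (Ioo_subset_Icc_self hy))
        (div_nonneg (sq_nonneg _) (by nlinarith [hy.1, hy.2]))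
    simp only [hE, hV]
    linarith
  have key : ∀ l r : ℝ, -1 < l → l ≤ r → r < 1 →
      V l * (N ^ 2 + (1 / 2 - (a ^ 2 + b ^ 2)) / 4) ≤ E r ∧
      V r * (N ^ 2 + (1 / 2 - (a ^ 2 + b ^ 2)) / 4) ≤ E l := by
    intro l r hl hlr hr
    have hs : Icc l r ⊆ Ioo (-1 : ℝ) 1 := Icc_subset_Ioo hl hr
    exact mul_le_energy (fun y hy => dφ y (hs hy)) (fun y hy => dE y (hs hy)) hm
      (fun y hy => hmφ y (hs hy)) (fun y hy => hV0 y (hs hy)) (fun y hy => hVE y (hs hy))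
      (exists_sign_change hA hB hl hlr hr)
  have hmain : V x₀ * (N ^ 2 + (1 / 2 - (a ^ 2 + b ^ 2)) / 4) ≤ E x := by
    rcases le_total x₀ x with h | h
    · exact (key x₀ x hx₀.1 h hx.2).1
    · exact (key x x₀ hx.1 h hx₀.2).2
  have hx2 : 0 < 1 - x ^ 2 := by nlinarith [hx.1, hx.2]
  refine (mul_le_mul_of_nonneg_right hmain (Real.sqrt_nonneg _)).trans_eq ?_
  rw [← hψ x hx]
  simp only [hE]
  rw [jacobiWeight_add_half a b hx]
  have := Real.mul_self_sqrt hx2.le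
  change _ = jacobiWeight a b x * (Z x ^ 2 + _)
  calc _ = jacobiWeight a b x * (√(1 - x ^ 2) * √(1 - x ^ 2)) *
      (Z x ^ 2 / (1 - x ^ 2) + φ x * P.eval x ^ 2) := by ring
    _ = _ := by rw [this]; field_simp

/-- The integral of the Sonin energy is a multiple of the weighted `L²` norm. -/
lemma IsMonicJacobi.integral_energy {a b : ℝ} {n : ℕ} {P : ℝ[X]} (hP : IsMonicJacobi a b n P)
    (ha : -1 < a) (hb : -1 < b) {p : ℝ}
    (hp : 2 * (4 * (n + (a + b + 1) / 2) ^ 2 - 1) * p = a ^ 2 - b ^ 2) :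
    ∫ x in (-1 : ℝ)..1, jacobiWeight a b x * (((1 - x ^ 2) * P.derivative.eval x +
        ((b + 1 / 2) * (1 - x) - (a + 1 / 2) * (1 + x)) / 2 * P.eval x) ^ 2 +
        ((n + (a + b + 1) / 2) ^ 2 * (1 - x ^ 2) + (1 / 4 - a ^ 2) * (1 + x) / 2
          + (1 / 4 - b ^ 2) * (1 - x) / 2) * P.eval x ^ 2) =
      ((n + (a + b + 1) / 2) ^ 2 + (1 / 2 - (a ^ 2 + b ^ 2)) / 2 + (a ^ 2 - b ^ 2) * p / 2) *
        ∫ x in (-1 : ℝ)..1, jacobiWeight a b x * P.eval x ^ 2 := by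
  refine integral_eq_mul_of_pearson ha hb
    ((C ((b - a) / 2) - C ((a + b + 1) / 2) * X
      - C (1 / 2) * (-X - C (a + b) * (C p + C (1 / 2) * X) +
          C (1 / 2) * (C (b - a) - C (a + b) * X))
      + C (n * (n + a + b + 1)) * (C p + C (1 / 2) * X)) * P ^ 2
      + (C (1 / 2) * (1 - X ^ 2) + (C (b - a) - C (a + b) * X) * (C p + C (1 / 2) * X))
        * (P * P.derivative)
      + (1 - X ^ 2) * (C p + C (1 / 2) * X) * P.derivative ^ 2) (d := 1)
    (by fun_prop) fun x _ => ?_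
  congr 1
  have ode := hP.eval_ode x
  simp only [derivative_add, derivative_sub, derivative_mul, derivative_pow, derivative_C,
    derivative_X, derivative_one, derivative_neg, eval_add, eval_sub, eval_mul, eval_pow, eval_C,
    eval_X, eval_one, eval_neg, eval_zero, Nat.cast_ofNat, Nat.add_one_sub_one, pow_one]
  generalize P.derivative.derivative.eval x = p2 at *
  generalize P.derivative.eval x = p1 at *
  generalize P.eval x = p0 at *
  linear_combination -(((1 - x ^ 2) / 2 + (b - a - (a + b) * x) * (p + x / 2)) * p0
    + 2 * ((1 - x ^ 2) * (p + x / 2)) * p1) * ode + x * p0 ^ 2 / 4 * hp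

lemma energy_constant_le {u v N p : ℝ} (hu : u ∈ Icc (0 : ℝ) (1 / 4)) (hv : v ∈ Icc (0 : ℝ) (1 / 4))
    (hN : 1 ≤ N) (hp : 2 * (4 * N ^ 2 - 1) * p = u - v) :
    N ^ 2 + (1 / 2 - (u + v)) / 2 + (u - v) * p / 2 ≤
      (1 + (1 / 2 - (u + v)) / (2 * N)) * (N ^ 2 + (1 / 2 - (u + v)) / 4) := by
  obtain ⟨hu0, hu1⟩ := hu
  obtain ⟨hv0, hv1⟩ := hv
  have hc0 : 0 ≤ 1 / 2 - (u + v) := by linarith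
  have h2 : (u - v) ^ 2 ≤ (1 / 2 - (u + v)) / 4 := by nlinarith
  have h3 : 6 ≤ 2 * (4 * N ^ 2 - 1) := by nlinarith
  have h5 : 0 ≤ (u - v) * p := by
    rw [← hp, mul_assoc]; exact mul_nonneg (by linarith) (mul_self_nonneg p)
  have h6 : 6 * ((u - v) * p) ≤ (u - v) ^ 2 := by
    calc _ ≤ 2 * (4 * N ^ 2 - 1) * ((u - v) * p) := mul_le_mul_of_nonneg_right h3 h5
      _ = (u - v) * (2 * (4 * N ^ 2 - 1) * p) := by ring
      _ = _ := by rw [hp]; ring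
  generalize 1 / 2 - (u + v) = c at *
  have h7 : (1 + c / (2 * N)) * (N ^ 2 + c / 4) = N ^ 2 + c / 4 + c * N / 2
      + c * (c / (8 * N)) := by
    field_simp
    ring
  have h8 : 0 ≤ c * (c / (8 * N)) := by positivity
  have h9 : c ≤ c * N := le_mul_of_one_le_right hc0 hN
  linarith

lemma IsMonicJacobi.jacobiWeight_mul_sq_le {a b : ℝ} {n : ℕ} {P : ℝ[X]}
    (hP : IsMonicJacobi a b n P) (hn : 1 ≤ n) (ha : |a| ≤ 1 / 2) (hb : |b| ≤ 1 / 2)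
    {x₀ : ℝ} (hx₀ : x₀ ∈ Ioo (-1 : ℝ) 1) :
    jacobiWeight (a + 1 / 2) (b + 1 / 2) x₀ * P.eval x₀ ^ 2 ≤ 2 * 2 ^ (-(2 * n + a + b)) := by
  obtain ⟨ha1, ha2⟩ := abs_le.mp ha
  obtain ⟨hb1, hb2⟩ := abs_le.mp hb
  have hN1 : 1 ≤ (n : ℝ) + (a + b + 1) / 2 := by
    have : (1 : ℝ) ≤ n := by exact_mod_cast hn
    linarith
  have hu : a ^ 2 ∈ Icc (0 : ℝ) (1 / 4) := ⟨sq_nonneg a, by nlinarith⟩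
  have hv : b ^ 2 ∈ Icc (0 : ℝ) (1 / 4) := ⟨sq_nonneg b, by nlinarith⟩
  have hL := hP.integral_sq_mul_le hn ha hb
  have henergy := fun x (hx : x ∈ Ioo (-1 : ℝ) 1) => hP.sq_mul_le_energy ha hb hn hx₀ hx
  have hint := fun p => hP.integral_energy (p := p) (by linarith) (by linarith)
  rw [show 2 * (n : ℝ) + a + b + 1 = 2 * (n + (a + b + 1) / 2) by ring] at hL
  set N := (n : ℝ) + (a + b + 1) / 2 with hN
  obtain ⟨p, hp⟩ : ∃ p, 2 * (4 * N ^ 2 - 1) * p = a ^ 2 - b ^ 2 :=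
    ⟨(a ^ 2 - b ^ 2) / (2 * (4 * N ^ 2 - 1)), mul_div_cancel₀ _ (by nlinarith)⟩
  have hκ := energy_constant_le hu hv hN1 hp
  set V := jacobiWeight (a + 1 / 2) (b + 1 / 2) x₀ * P.eval x₀ ^ 2 with hV
  have hlow : V * (N ^ 2 + (1 / 2 - (a ^ 2 + b ^ 2)) / 4) * (Real.pi / 2) ≤
      (N ^ 2 + (1 / 2 - (a ^ 2 + b ^ 2)) / 2 + (a ^ 2 - b ^ 2) * p / 2) *
        ∫ x in (-1 : ℝ)..1, jacobiWeight a b x * P.eval x ^ 2 := by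
    rw [← hint p hp, ← integral_sqrt_one_sub_sq, ← intervalIntegral.integral_const_mul]
    refine intervalIntegral.integral_mono_on_of_le_Ioo (by norm_num) ?_ ?_ henergy
    · exact Continuous.intervalIntegrable (by fun_prop) _ _
    · exact intervalIntegrable_jacobiWeight_mul (by linarith) (by linarith) (by fun_prop)
  have hI0 : 0 ≤ ∫ x in (-1 : ℝ)..1, jacobiWeight a b x * P.eval x ^ 2 :=
    intervalIntegral.integral_nonneg (by norm_num) fun x hx =>
      mul_nonneg (jacobiWeight_nonneg _ _ hx) (sq_nonneg _)
  have hm : 0 < N ^ 2 + (1 / 2 - (a ^ 2 + b ^ 2)) / 4 := by nlinarith [hu.2, hv.2]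
  generalize (∫ x in (-1 : ℝ)..1, jacobiWeight a b x * P.eval x ^ 2) = I at *
  generalize N ^ 2 + (1 / 2 - (a ^ 2 + b ^ 2)) / 4 = m at *
  have h1 : (V * (Real.pi / 2)) * m ≤ (Real.pi * 2 ^ (-(2 * n + a + b))) * m := by
    calc (V * (Real.pi / 2)) * m = V * m * (Real.pi / 2) := by ring
      _ ≤ _ := hlow
      _ ≤ _ := mul_le_mul_of_nonneg_right hκ hI0
      _ = (I * (1 + (1 / 2 - (a ^ 2 + b ^ 2)) / (2 * N))) * m := by ring
      _ ≤ _ := mul_le_mul_of_nonneg_right hL hm.le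
  have h2 := le_of_mul_le_mul_right h1 hm
  refine le_of_mul_le_mul_right ?_ (half_pos Real.pi_pos)
  linarith

lemma jacobiSup_nonneg_s6 (ρa ρb : ℝ) (P : ℝ[X]) : 0 ≤ jacobiSup ρa ρb P := by
  refine Real.sSup_nonneg ?_
  rintro _ ⟨x, hx, rfl⟩
  exact mul_nonneg (jacobiWeight_nonneg ρa ρb hx) (abs_nonneg _)

lemma le_jacobiSup {ρa ρb : ℝ} (ha : 0 ≤ ρa) (hb : 0 ≤ ρb) (P : ℝ[X]) {x : ℝ}
    (hx : x ∈ Icc (-1 : ℝ) 1) :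
    jacobiWeight ρa ρb x * |P.eval x| ≤ jacobiSup ρa ρb P :=
  le_csSup (isCompact_Icc.bddAbove_image
    (((continuous_jacobiWeight ha hb).mul P.continuous.abs).continuousOn)) ⟨x, hx, rfl⟩

lemma jacobiSup_le {ρa ρb M : ℝ} (ha : 0 ≤ ρa) (hb : 0 ≤ ρb) {P : ℝ[X]}
    (h : ∀ x ∈ Ioo (-1 : ℝ) 1, jacobiWeight ρa ρb x * |P.eval x| ≤ M) :
    jacobiSup ρa ρb P ≤ M := by
  have hcl : Icc (-1 : ℝ) 1 ⊆ {x | jacobiWeight ρa ρb x * |P.eval x| ≤ M} := by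
    rw [← closure_Ioo (by norm_num : (-1 : ℝ) ≠ 1)]
    exact closure_minimal h (isClosed_le
      ((continuous_jacobiWeight ha hb).mul P.continuous.abs) continuous_const)
  refine csSup_le ⟨_, 0, by norm_num, rfl⟩ ?_
  rintro _ ⟨x, hx, rfl⟩
  exact hcl hx

/-- Upper bound for the Widom factors, attained by the monic Jacobi polynomials with parameters
`2 ρa - 1 / 2` and `2 ρb - 1 / 2`. -/
lemma widomFactor_le {ρa ρb : ℝ} (ha : ρa ∈ Icc (0 : ℝ) (1 / 2)) (hb : ρb ∈ Icc (0 : ℝ) (1 / 2))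
    {n : ℕ} (hn : 1 ≤ n) : widomFactor ρa ρb n ≤ 2 ^ (1 - ρa - ρb) := by
  obtain ⟨P, hP⟩ := exists_isMonicJacobi n (2 * ρa - 1 / 2) (2 * ρb - 1 / 2)
    (by linarith [ha.1]) (by linarith [hb.1])
  have hsup : jacobiSup ρa ρb P ≤ 2 ^ (1 - ρa - ρb - n) := by
    refine jacobiSup_le ha.1 hb.1 fun x hx => ?_
    have h := hP.jacobiWeight_mul_sq_le hn
      (abs_le.mpr ⟨by linarith [ha.1], by linarith [ha.2]⟩)
      (abs_le.mpr ⟨by linarith [hb.1], by linarith [hb.2]⟩) hx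
    refine abs_le_of_sq_le_sq' ?_ (by positivity) |>.2
    have h1 : 0 ≤ 1 - x := by linarith [hx.2]
    have h2 : 0 ≤ 1 + x := by linarith [hx.1]
    calc (jacobiWeight ρa ρb x * |P.eval x|) ^ 2
        = jacobiWeight (2 * ρa - 1 / 2 + 1 / 2) (2 * ρb - 1 / 2 + 1 / 2) x * P.eval x ^ 2 := by
          simp only [jacobiWeight, sub_add_cancel]
          rw [mul_pow, sq_abs, mul_pow, ← Real.rpow_mul_natCast h1, ← Real.rpow_mul_natCast h2]
          norm_num [mul_comm]
      _ ≤ _ := h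
      _ = 2 ^ (1 + -(2 * (n : ℝ) + (2 * ρa - 1 / 2) + (2 * ρb - 1 / 2))) := by
          rw [Real.rpow_add two_pos, Real.rpow_one]
      _ = _ := by
          rw [← Real.rpow_mul_natCast two_pos.le]
          congr 1
          push_cast
          ring
  calc widomFactor ρa ρb n ≤ 2 ^ n * 2 ^ (1 - ρa - ρb - n) := by
        refine mul_le_mul_of_nonneg_left (le_trans (csInf_le ?_ ?_) hsup) (by positivity)
        · exact ⟨0, by rintro _ ⟨Q, -, rfl⟩; exact jacobiSup_nonneg_s6 ρa ρb Q⟩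
        · exact ⟨P, ⟨hP.monic, hP.natDegree_eq⟩, rfl⟩
    _ = _ := by
        rw [← Real.rpow_natCast, ← Real.rpow_add two_pos]
        congr 1
        ring

/-- `z ^ n * P ((z + z⁻¹) / 2)` written as a polynomial expression in `z`. -/
lemma exists_differentiable_joukowski (P : ℝ[X]) (hP : P.Monic) :
    ∃ R : ℂ → ℂ, Differentiable ℂ R ∧ R 0 = (2 ^ P.natDegree)⁻¹ ∧
      ∀ z : ℂ, ‖z‖ = 1 → R z = z ^ P.natDegree * (P.eval z.re : ℝ) := by
  refine ⟨fun z => ∑ k ∈ Finset.range (P.natDegree + 1),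
    (P.coeff k : ℂ) * ((z ^ 2 + 1) / 2) ^ k * z ^ (P.natDegree - k), by fun_prop, ?_, ?_⟩
  · simp only
    rw [Finset.sum_eq_single_of_mem P.natDegree (by simp)]
    · simp [hP.coeff_natDegree]
    · intro k hk hne
      have : P.natDegree - k ≠ 0 := by
        have := Finset.mem_range.mp hk
        omega
      simp [this]
  · intro z hz
    have h1 : (z ^ 2 + 1) / 2 = z * (z.re : ℂ) := by
      have h2 : z * (starRingEnd ℂ) z = 1 := by
        rw [Complex.mul_conj, Complex.normSq_eq_norm_sq, hz]; simp
      have h3 := Complex.add_conj z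
      push_cast at h3
      linear_combination (1 / 2 : ℂ) * z * h3 - (1 / 2 : ℂ) * h2
    rw [P.eval_eq_sum_range, Complex.ofReal_sum, Finset.mul_sum]
    refine Finset.sum_congr rfl fun k hk => ?_
    have hk' : k ≤ P.natDegree := by
      have := Finset.mem_range.mp hk
      omega
    rw [h1, ← Nat.add_sub_cancel' hk']
    push_cast
    rw [Nat.add_sub_cancel_left]
    ring

/-- The conjugate reflection `z ^ m * conj (h z)` across the unit circle extends analytically. -/
lemma exists_differentiable_reflection (h : ℂ[X]) {m : ℕ} (hm : h.natDegree < m) :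
    ∃ S : ℂ → ℂ, Differentiable ℂ S ∧ S 0 = 0 ∧
      ∀ z : ℂ, ‖z‖ = 1 → S z = z ^ m * (starRingEnd ℂ) (h.eval z) := by
  refine ⟨fun z => ∑ k ∈ Finset.range (h.natDegree + 1),
    (starRingEnd ℂ) (h.coeff k) * z ^ (m - k), by fun_prop, ?_, ?_⟩
  · refine Finset.sum_eq_zero fun k hk => ?_
    have : m - k ≠ 0 := by
      have := Finset.mem_range.mp hk
      omega
    simp [this]
  · intro z hz
    have h2 : z * (starRingEnd ℂ) z = 1 := by
      rw [Complex.mul_conj, Complex.normSq_eq_norm_sq, hz]; simp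
    rw [h.eval_eq_sum_range, map_sum, Finset.mul_sum]
    refine Finset.sum_congr rfl fun k hk => ?_
    have hk' : k ≤ m := by
      have := Finset.mem_range.mp hk
      omega
    rw [map_mul, map_pow]
    calc _ = (starRingEnd ℂ) (h.coeff k) * z ^ (m - k) * (z * (starRingEnd ℂ) z) ^ k := by
          rw [h2]; simp
      _ = (z ^ (m - k) * z ^ k) * ((starRingEnd ℂ) (h.coeff k) * (starRingEnd ℂ) z ^ k) := by ring
      _ = _ := by rw [← pow_add, Nat.sub_add_cancel hk']

lemma re_apply_zero_nonneg {H : ℂ → ℂ} (hd : DiffContOnCl ℂ H (Metric.ball 0 1))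
    (h : ∀ z : ℂ, ‖z‖ = 1 → 0 ≤ (H z).re) : 0 ≤ (H 0).re := by
  have hexp : DiffContOnCl ℂ (fun z => Complex.exp (-H z)) (Metric.ball 0 1) :=
    Complex.differentiable_exp.comp_diffContOnCl hd.neg
  have := Complex.norm_le_of_forall_mem_frontier_norm_le (C := 1) Metric.isBounded_ball hexp
    (fun z hz => ?_) (subset_closure (Metric.mem_ball_self one_pos))
  · simpa [Complex.norm_exp] using this
  · rw [frontier_ball _ one_ne_zero, mem_sphere_zero_iff_norm] at hz
    simpa [Complex.norm_exp] using h z hz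

lemma re_two_mul_div_le {e : ℂ} (he : ‖e‖ = 1) {r g c : ℝ} (hr0 : 0 ≤ r) (hr1 : r < 1)
    (hg : |g| ≤ c) :
    (-(2 * r * Complex.I) * g * e / (1 + r ^ 2 * e ^ 2)).re ≤
      c * ((1 - r ^ 2 * e ^ 2) / (1 + r ^ 2 * e ^ 2)).re := by
  have hn : e.re ^ 2 + e.im ^ 2 = 1 := by
    have := Complex.normSq_apply e
    rw [Complex.normSq_eq_norm_sq, he] at this
    linarith
  have hsq : r ^ 2 < 1 := by nlinarith
  have hpos : 0 < Complex.normSq (1 + r ^ 2 * e ^ 2) := by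
    rw [Complex.normSq_pos]
    intro h0
    have h1 : (r : ℂ) ^ 2 * e ^ 2 = -1 := by linear_combination h0
    have h2 := congrArg norm h1
    rw [norm_mul, norm_pow, norm_pow, he, norm_neg, norm_one] at h2
    simp only [Complex.norm_real, Real.norm_eq_abs, sq_abs, one_pow, mul_one] at h2
    linarith
  have hc0 : 0 ≤ c := (abs_nonneg g).trans hg
  have him : |e.im| ≤ 1 := he ▸ Complex.abs_im_le_norm e
  have hge : g * e.im ≤ c := (le_abs_self _).trans (by
    rw [abs_mul]; nlinarith [abs_nonneg g, abs_nonneg e.im])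
  rw [Complex.div_re, Complex.div_re, ← add_div, ← add_div, mul_div_assoc']
  refine div_le_div_of_nonneg_right ?_ hpos.le
  have h1 : (r : ℂ) ^ 2 = ((r ^ 2 : ℝ) : ℂ) := by push_cast; rfl
  simp only [h1, pow_two e, Complex.mul_re, Complex.mul_im, Complex.add_re, Complex.add_im,
    Complex.sub_re, Complex.sub_im, Complex.one_re, Complex.one_im, Complex.ofReal_re,
    Complex.ofReal_im, Complex.I_re, Complex.I_im, Complex.neg_re, Complex.neg_im,
    Complex.re_ofNat, Complex.im_ofNat]
  have e2 : 2 * r * (g * e.im) * (1 - r ^ 2) ≤ c * (1 + r ^ 2) * (1 - r ^ 2) :=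
    mul_le_mul_of_nonneg_right (by nlinarith [sq_nonneg (1 - r)]) (by linarith)
  calc _ = 2 * r * (g * e.im) * (1 - r ^ 2 * (e.re ^ 2 + e.im ^ 2)) := by ring
    _ ≤ c * (1 + r ^ 2 * (e.re ^ 2 + e.im ^ 2)) * (1 - r ^ 2 * (e.re ^ 2 + e.im ^ 2)) := by
        rwa [hn, mul_one]
    _ = _ := by ring

/-- A polynomial majorant `h` of `sin θ * P (cos θ)` on the unit circle with `h 0 = 1` and without
zeros in the closed unit disc bounds the leading coefficient of `P`. -/
lemma one_le_mul_two_pow_of_majorant {P : ℝ[X]} (hP : P.Monic) {h : ℂ[X]} (h0 : h.eval 0 = 1)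
    (hne : ∀ z : ℂ, ‖z‖ ≤ 1 → h.eval z ≠ 0) (hdeg : h.natDegree < 2 * P.natDegree + 2) {c : ℝ}
    (hc : ∀ z : ℂ, ‖z‖ = 1 → |z.im * P.eval z.re| ≤ c * ‖h.eval z‖) :
    1 ≤ c * 2 ^ P.natDegree := by
  obtain ⟨R, hRd, hR0, hR⟩ := exists_differentiable_joukowski P hP
  obtain ⟨S, hSd, hS0, hS⟩ := exists_differentiable_reflection h hdeg
  have hcl : closure (Metric.ball (0 : ℂ) 1) = Metric.closedBall 0 1 :=
    closure_ball _ one_ne_zero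
  have hSb : ∀ z : ℂ, ‖z‖ ≤ 1 → ‖S z / h.eval z‖ ≤ 1 := by
    intro z hz
    refine Complex.norm_le_of_forall_mem_frontier_norm_le (f := fun z => S z / h.eval z)
      Metric.isBounded_ball (DifferentiableOn.diffContOnCl fun w hw => ?_) (fun w hw => ?_)
      (hcl ▸ mem_closedBall_zero_iff.mpr hz)
    · rw [hcl, mem_closedBall_zero_iff] at hw
      exact (hSd.differentiableAt.div h.differentiable.differentiableAt
        (hne w hw)).differentiableWithinAt
    · rw [frontier_ball _ one_ne_zero, mem_sphere_zero_iff_norm] at hw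
      rw [hS w hw, norm_div, norm_mul, norm_pow, hw, RCLike.norm_conj, one_pow, one_mul,
        div_self (norm_ne_zero_iff.mpr (hne w hw.le))]
  have key : ∀ r : ℝ, 0 ≤ r → r < 1 → r ≤ c * 2 ^ P.natDegree := by
    intro r hr0 hr1
    have hden : ∀ z : ℂ, ‖z‖ ≤ 1 → 1 + (r : ℂ) ^ 2 * (S z / h.eval z) ≠ 0 := by
      intro z hz hzero
      have h1 : (r : ℂ) ^ 2 * (S z / h.eval z) = -1 := by linear_combination hzero
      have h2 := congrArg norm h1
      rw [norm_mul, norm_pow, norm_neg, norm_one, Complex.norm_real, Real.norm_eq_abs, sq_abs] at h2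
      nlinarith [hSb z hz, norm_nonneg (S z / h.eval z)]
    set H : ℂ → ℂ := fun z => c * ((1 - r ^ 2 * (S z / h.eval z)) / (1 + r ^ 2 * (S z / h.eval z)))
      - -(2 * r * Complex.I) * ((z ^ 2 - 1) / (2 * Complex.I) * R z / h.eval z) /
        (1 + r ^ 2 * (S z / h.eval z)) with hH
    have hHd : DiffContOnCl ℂ H (Metric.ball 0 1) := by
      refine DifferentiableOn.diffContOnCl fun w hw => ?_
      rw [hcl, mem_closedBall_zero_iff] at hw
      have h1 := hne w hw
      have h2 := hden w hw
      have h3 : DifferentiableAt ℂ (fun z => h.eval z) w := h.differentiable.differentiableAt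
      have h4 : DifferentiableAt ℂ R w := hRd.differentiableAt
      have h5 : DifferentiableAt ℂ S w := hSd.differentiableAt
      refine DifferentiableAt.differentiableWithinAt ?_
      simp only [hH]
      fun_prop (disch := first | assumption | simp)
    have hH0 : (H 0).re = c - r * (2 ^ P.natDegree)⁻¹ := by
      have h1 : H 0 = ((c - r * (2 ^ P.natDegree)⁻¹ : ℝ) : ℂ) := by
        simp only [hH, hS0, h0, hR0]
        push_cast
        field_simp
        ring
      rw [h1, Complex.ofReal_re]
    have hpos := re_apply_zero_nonneg hHd fun z hz => ?_
    · rw [hH0] at hpos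
      have h2 : (0 : ℝ) < 2 ^ P.natDegree := by positivity
      rw [sub_nonneg, ← div_eq_mul_inv, div_le_iff₀ h2] at hpos
      exact hpos
    · have hnz := hne z hz.le
      have hn0 : (‖h.eval z‖ : ℂ) ≠ 0 := by
        exact_mod_cast norm_ne_zero_iff.mpr hnz
      have hzz : z * (starRingEnd ℂ) z = 1 := by
        rw [Complex.mul_conj, Complex.normSq_eq_norm_sq, hz]; simp
      have hhh : h.eval z * (starRingEnd ℂ) (h.eval z) = (‖h.eval z‖ : ℂ) ^ 2 := by
        rw [Complex.mul_conj, Complex.normSq_eq_norm_sq]; push_cast; rfl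
      have hsub := Complex.sub_conj z
      set e : ℂ := z ^ (P.natDegree + 1) * ‖h.eval z‖ / h.eval z with he
      have he1 : ‖e‖ = 1 := by
        rw [he, norm_div, norm_mul, norm_pow, hz, Complex.norm_real, norm_norm, one_pow, one_mul,
          div_self (norm_ne_zero_iff.mpr hnz)]
      have hSe : S z / h.eval z = e ^ 2 := by
        rw [hS z hz, he]
        field_simp
        rw [← hhh]
        ring
      have hGe : (z ^ 2 - 1) / (2 * Complex.I) * R z / h.eval z =
          ((z.im * P.eval z.re / ‖h.eval z‖ : ℝ) : ℂ) * e := by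
        have h3 : (z ^ 2 - 1) / (2 * Complex.I) = z * z.im := by
          have : z ^ 2 - 1 = z * (z - (starRingEnd ℂ) z) := by rw [mul_sub, hzz]; ring
          rw [this, hsub]
          push_cast
          field_simp
        rw [h3, hR z hz, he]
        push_cast
        field_simp
        ring
      have := re_two_mul_div_le he1 hr0 hr1 (g := z.im * P.eval z.re / ‖h.eval z‖) (c := c) (by
        rw [abs_div, abs_norm, div_le_iff₀ (norm_pos_iff.mpr hnz)]; exact hc z hz)
      simp only [hH]
      rw [hSe, hGe, Complex.sub_re, Complex.re_ofReal_mul, sub_nonneg]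
      rwa [← mul_assoc]
  refine le_of_forall_lt fun r hr => ?_
  rcases lt_or_ge r 0 with h1 | h1
  · exact h1.trans_le (key 0 le_rfl one_pos)
  · exact lt_of_lt_of_le (by linarith : r < (r + 1) / 2) (key _ (by linarith) (by linarith))

lemma exists_polynomial_near {f : ℂ → ℂ} {r : ℝ} (hr : 1 < r)
    (hf : DifferentiableOn ℂ f (Metric.closedBall 0 r)) {ε : ℝ} (hε : 0 < ε) :
    ∃ h : ℂ[X], h.eval 0 = f 0 ∧ ∀ z : ℂ, ‖z‖ ≤ 1 → ‖h.eval z - f z‖ < ε := by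
  lift r to NNReal using by linarith
  have hps := hf.hasFPowerSeriesOnBall (by exact_mod_cast one_pos.trans hr)
  set p := cauchyPowerSeries f 0 r with hp
  obtain ⟨s, hs1, hs2⟩ := exists_between hr
  lift s to NNReal using by linarith
  have hu := hps.tendstoUniformlyOn (r' := s) (by exact_mod_cast hs2)
  obtain ⟨N, hN, hN1⟩ := ((Metric.tendstoUniformlyOn_iff.mp hu ε hε).and
    (Filter.eventually_ge_atTop 1)).exists
  have heval : ∀ z : ℂ, (∑ k ∈ Finset.range N, Polynomial.C (p.coeff k) * X ^ k).eval z =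
      p.partialSum N z := by
    intro z
    simp only [eval_finsetSum, eval_mul, eval_C, eval_pow, eval_X,
      FormalMultilinearSeries.partialSum, FormalMultilinearSeries.apply_eq_pow_smul_coeff,
      smul_eq_mul, mul_comm]
  refine ⟨∑ k ∈ Finset.range N, Polynomial.C (p.coeff k) * X ^ k, ?_, fun z hz => ?_⟩
  · rw [← hps.coeff_zero (fun _ => 0), heval, FormalMultilinearSeries.partialSum,
      Finset.sum_eq_single_of_mem 0 (by simpa using Nat.lt_of_succ_le hN1)]
    intro k _ hk
    simp [hk]
  · rw [heval, ← dist_eq_norm, dist_comm]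
    have := hN z (by rw [Metric.mem_ball, dist_zero_right]; linarith)
    simpa using this

lemma two_pow_mul_jacobiSup_ge {ρa ρb q : ℝ} (ha : ρa ∈ Icc (0 : ℝ) (1 / 2))
    (hb : ρb ∈ Icc (0 : ℝ) (1 / 2)) (hq0 : 0 < q) (hq1 : q < 1) :
    ∃ n : ℕ, 1 ≤ n ∧ ∀ P : ℝ[X], P.Monic → P.natDegree = n →
      q * ((1 + q) ^ 2 / 2) ^ (1 - ρa - ρb) ≤ 2 ^ n * jacobiSup ρa ρb P := by
  set s := 1 - 2 * ρa with hs
  set t := 1 - 2 * ρb with ht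
  have hs0 : 0 ≤ s := by linarith [ha.2]
  have ht0 : 0 ≤ t := by linarith [hb.2]
  set D : ℂ → ℂ := fun z => (1 - q * z) ^ (s : ℂ) * (1 + q * z) ^ (t : ℂ) with hD
  have hnormD : ∀ z, ‖D z‖ = ‖1 - q * z‖ ^ s * ‖1 + q * z‖ ^ t := by
    intro z
    rw [hD, norm_mul, Complex.norm_cpow_real, Complex.norm_cpow_real]
  obtain ⟨r, hr1, hr2⟩ := exists_between ((one_lt_inv₀ hq0).mpr hq1)
  have hqz : ∀ z : ℂ, ‖z‖ ≤ r → ‖(q : ℂ) * z‖ < 1 := by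
    intro z hz
    rw [norm_mul, Complex.norm_real, Real.norm_of_nonneg hq0.le]
    calc q * ‖z‖ ≤ q * r := by gcongr
      _ < q * q⁻¹ := by gcongr
      _ = 1 := mul_inv_cancel₀ hq0.ne'
  have hDd : DifferentiableOn ℂ D (Metric.closedBall 0 r) := by
    intro z hz
    have h1 := hqz z (mem_closedBall_zero_iff.mp hz)
    have h2 : 1 + (q : ℂ) * z ∈ Complex.slitPlane := Complex.mem_slitPlane_of_norm_lt_one h1
    have h3 : 1 - (q : ℂ) * z ∈ Complex.slitPlane := by
      rw [sub_eq_add_neg]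
      exact Complex.mem_slitPlane_of_norm_lt_one (by rwa [norm_neg])
    refine DifferentiableAt.differentiableWithinAt ?_
    simp only [hD]
    have d1 : DifferentiableAt ℂ (fun z : ℂ => 1 - (q : ℂ) * z) z := by fun_prop
    have d2 : DifferentiableAt ℂ (fun z : ℂ => 1 + (q : ℂ) * z) z := by fun_prop
    exact (d1.cpow_const h3).mul (d2.cpow_const h2)
  have hDlow : ∀ z : ℂ, ‖z‖ ≤ 1 → (1 - q) ^ s * (1 - q) ^ t ≤ ‖D z‖ := by
    intro z hz
    have h0 : ‖(q : ℂ) * z‖ ≤ q := by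
      rw [norm_mul, Complex.norm_real, Real.norm_of_nonneg hq0.le]
      nlinarith
    have h1 : 1 - q ≤ ‖1 - (q : ℂ) * z‖ := by
      have := norm_sub_norm_le (1 : ℂ) (q * z)
      rw [norm_one] at this
      linarith
    have h2 : 1 - q ≤ ‖1 + (q : ℂ) * z‖ := by
      have := norm_sub_norm_le (1 : ℂ) (-(q * z))
      rw [norm_one, norm_neg, sub_neg_eq_add] at this
      linarith
    have h3 : 0 ≤ 1 - q := by linarith
    rw [hnormD]
    gcongr
  have hlow : 0 < (1 - q) ^ s * (1 - q) ^ t :=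
    mul_pos (Real.rpow_pos_of_pos (by linarith) _) (Real.rpow_pos_of_pos (by linarith) _)
  obtain ⟨h, h0, hh⟩ := exists_polynomial_near hr1 hDd (mul_pos (sub_pos.mpr hq1) hlow)
  have hhD : ∀ z : ℂ, ‖z‖ ≤ 1 → q * ‖D z‖ ≤ ‖h.eval z‖ := by
    intro z hz
    have h1 := norm_sub_norm_le (D z) (h.eval z)
    rw [norm_sub_rev] at h1
    have h2 := mul_le_mul_of_nonneg_left (hDlow z hz) (sub_pos.mpr hq1).le
    linarith [hh z hz]
  refine ⟨h.natDegree + 1, by omega, fun P hP hdeg => ?_⟩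
  set M := jacobiSup ρa ρb P with hM
  have hk : 0 < (1 + q) ^ 2 / 2 := by positivity
  set k := (1 + q) ^ 2 / 2 with hkdef
  have main := one_le_mul_two_pow_of_majorant hP (h := h) (c := M * (k ^ (1 - ρa - ρb))⁻¹ / q)
    (by rw [h0]; simp [hD]) (fun z hz => ?_) (by omega) fun z hz => ?_
  · rw [hdeg] at main
    have h1 := Real.rpow_pos_of_pos hk (1 - ρa - ρb)
    have h2 : M * (k ^ (1 - ρa - ρb))⁻¹ / q * 2 ^ (h.natDegree + 1) =
      2 ^ (h.natDegree + 1) * M / (q * k ^ (1 - ρa - ρb)) := by field_simp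
    rwa [h2, one_le_div (by positivity)] at main
  · exact norm_pos_iff.mp ((mul_pos hq0 (hlow.trans_le (hDlow z hz))).trans_le (hhD z hz))
  · have hn : z.re ^ 2 + z.im ^ 2 = 1 := by
      have := Complex.normSq_apply z
      rw [Complex.normSq_eq_norm_sq, hz] at this
      linarith
    have hx : z.re ∈ Icc (-1 : ℝ) 1 := ⟨by nlinarith [sq_nonneg z.im], by nlinarith [sq_nonneg z.im]⟩
    have hx1 : 0 ≤ 1 - z.re := by linarith [hx.2]
    have hx2 : 0 ≤ 1 + z.re := by linarith [hx.1]
    have hM0 := le_jacobiSup ha.1 hb.1 P hx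
    have hqn : q ^ 2 * (z.re ^ 2 + z.im ^ 2) = q ^ 2 := by rw [hn, mul_one]
    have n1 : k * (1 - z.re) ≤ ‖1 - (q : ℂ) * z‖ ^ 2 := by
      rw [← Complex.normSq_eq_norm_sq, Complex.normSq_apply, hkdef]
      simp only [Complex.sub_re, Complex.sub_im, Complex.one_re,
        Complex.one_im, Complex.re_ofReal_mul, Complex.im_ofReal_mul]
      linarith [mul_nonneg (sq_nonneg (1 - q)) hx2]
    have n2 : k * (1 + z.re) ≤ ‖1 + (q : ℂ) * z‖ ^ 2 := by
      rw [← Complex.normSq_eq_norm_sq, Complex.normSq_apply, hkdef]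
      simp only [Complex.add_re, Complex.add_im, Complex.one_re,
        Complex.one_im, Complex.re_ofReal_mul, Complex.im_ofReal_mul]
      linarith [mul_nonneg (sq_nonneg (1 - q)) hx1]
    have m1 : k ^ (s / 2) * (1 - z.re) ^ (s / 2) ≤ ‖1 - (q : ℂ) * z‖ ^ s := by
      rw [← Real.mul_rpow hk.le hx1]
      refine (Real.rpow_le_rpow (by positivity) n1 (by linarith)).trans_eq ?_
      rw [← Real.rpow_natCast_mul (norm_nonneg _)]
      congr 1
      push_cast
      ring
    have m2 : k ^ (t / 2) * (1 + z.re) ^ (t / 2) ≤ ‖1 + (q : ℂ) * z‖ ^ t := by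
      rw [← Real.mul_rpow hk.le hx2]
      refine (Real.rpow_le_rpow (by positivity) n2 (by linarith)).trans_eq ?_
      rw [← Real.rpow_natCast_mul (norm_nonneg _)]
      congr 1
      push_cast
      ring
    have him : |z.im| = jacobiWeight ρa ρb z.re * ((1 - z.re) ^ (s / 2) * (1 + z.re) ^ (t / 2)) := by
      have e1 : (1 - z.re) ^ ρa * (1 - z.re) ^ (s / 2) = √(1 - z.re) := by
        rw [← Real.rpow_add_of_nonneg hx1 ha.1 (by linarith), Real.sqrt_eq_rpow, hs]
        congr 1
        ring
      have e2 : (1 + z.re) ^ ρb * (1 + z.re) ^ (t / 2) = √(1 + z.re) := by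
        rw [← Real.rpow_add_of_nonneg hx2 hb.1 (by linarith), Real.sqrt_eq_rpow, ht]
        congr 1
        ring
      calc |z.im| = √(z.im ^ 2) := (Real.sqrt_sq_eq_abs _).symm
        _ = √((1 - z.re) * (1 + z.re)) := by congr 1; linarith
        _ = √(1 - z.re) * √(1 + z.re) := Real.sqrt_mul hx1 _
        _ = _ := by rw [← e1, ← e2, jacobiWeight]; ring
    have hMnn : 0 ≤ M := jacobiSup_nonneg_s6 _ _ _
    have hkk : k ^ (1 - ρa - ρb) = k ^ (s / 2) * k ^ (t / 2) := by
      rw [← Real.rpow_add hk]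
      congr 1
      rw [hs, ht]
      ring
    have hkp := Real.rpow_pos_of_pos hk (1 - ρa - ρb)
    have step : k ^ (1 - ρa - ρb) * |z.im * P.eval z.re| ≤ M * ‖D z‖ := by
      calc _ = (jacobiWeight ρa ρb z.re * |P.eval z.re|) *
          ((k ^ (s / 2) * (1 - z.re) ^ (s / 2)) * (k ^ (t / 2) * (1 + z.re) ^ (t / 2))) := by
            rw [abs_mul, him, hkk]; ring
        _ ≤ M * (‖1 - (q : ℂ) * z‖ ^ s * ‖1 + (q : ℂ) * z‖ ^ t) := by gcongr
        _ = _ := by rw [hnormD]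
    calc |z.im * P.eval z.re| = (k ^ (1 - ρa - ρb))⁻¹ *
          (k ^ (1 - ρa - ρb) * |z.im * P.eval z.re|) := by field_simp
      _ ≤ (k ^ (1 - ρa - ρb))⁻¹ * (M * ‖D z‖) := by gcongr
      _ = M * (k ^ (1 - ρa - ρb))⁻¹ / q * (q * ‖D z‖) := by field_simp
      _ ≤ _ := mul_le_mul_of_nonneg_left (hhD z hz.le) (by positivity)

lemma exists_le_widomFactor {ρa ρb q : ℝ} (ha : ρa ∈ Icc (0 : ℝ) (1 / 2))
    (hb : ρb ∈ Icc (0 : ℝ) (1 / 2)) (hq0 : 0 < q) (hq1 : q < 1) :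
    ∃ n : ℕ, 1 ≤ n ∧ q * ((1 + q) ^ 2 / 2) ^ (1 - ρa - ρb) ≤ widomFactor ρa ρb n := by
  obtain ⟨n, hn, h⟩ := two_pow_mul_jacobiSup_ge ha hb hq0 hq1
  refine ⟨n, hn, ?_⟩
  rw [widomFactor, ← div_le_iff₀' (by positivity)]
  refine le_csInf ⟨_, X ^ n, ⟨monic_X_pow n, natDegree_X_pow n⟩, rfl⟩ ?_
  rintro _ ⟨P, ⟨hP, hdeg⟩, rfl⟩
  rw [div_le_iff₀' (by positivity)]
  exact h P hP hdeg

theorem widomFactor_le_and_sup_eq (ρa ρb : ℝ)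
    (hρa : ρa ∈ Set.Icc (0 : ℝ) (1 / 2)) (hρb : ρb ∈ Set.Icc (0 : ℝ) (1 / 2)) :
    (∀ n : ℕ, 1 ≤ n → widomFactor ρa ρb n ≤ (2 : ℝ) ^ (1 - ρa - ρb)) ∧
      (⨆ n : (Set.Ici 1 : Set ℕ), widomFactor ρa ρb n.1) = (2 : ℝ) ^ (1 - ρa - ρb) := by
  have hle : ∀ n : ℕ, 1 ≤ n → widomFactor ρa ρb n ≤ (2 : ℝ) ^ (1 - ρa - ρb) :=
    fun n hn => widomFactor_le hρa hρb hn
  refine ⟨hle, le_antisymm ?_ ?_⟩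
  · have : Nonempty (Set.Ici 1 : Set ℕ) := ⟨⟨1, Set.mem_Ici.mpr le_rfl⟩⟩
    exact ciSup_le fun n => hle n.1 n.2
  · have hbdd : BddAbove (Set.range fun n : (Set.Ici 1 : Set ℕ) => widomFactor ρa ρb n.1) :=
      ⟨_, by rintro _ ⟨n, rfl⟩; exact hle n.1 n.2⟩
    have hcont : ContinuousAt (fun q : ℝ => q * ((1 + q) ^ 2 / 2) ^ (1 - ρa - ρb)) 1 := by
      refine continuousAt_id.mul (ContinuousAt.rpow_const (by fun_prop) (Or.inl (by norm_num)))
    have hlim : Filter.Tendsto (fun q : ℝ => q * ((1 + q) ^ 2 / 2) ^ (1 - ρa - ρb))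
        (nhdsWithin 1 (Iio 1)) (nhds (2 ^ (1 - ρa - ρb))) := by
      have := hcont.tendsto.mono_left (nhdsWithin_le_nhds (s := Iio 1))
      norm_num at this
      exact this
    refine le_of_tendsto hlim ?_
    filter_upwards [Ioo_mem_nhdsLT (zero_lt_one : (0 : ℝ) < 1)] with q hq
    obtain ⟨n, hn, h⟩ := exists_le_widomFactor hρa hρb hq.1 hq.2
    exact h.trans (le_ciSup hbdd ⟨n, hn⟩)
end
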